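/- arXiv:1403.3440 — 8 statements merged into one kernel-verified Lean document; each statement's English description precedes it below -/
import Mathlib

section
/- Let A be a C*-algebra, let B ⊆ A be a C*-subalgebra (a closed *-subalgebra), and let I₁ ⊆ I₂ ⊆ ⋯ be an increasing sequence of closed two-sided ideals of A. Then B ∩ closure(⋃_{n=1}^∞ Iₙ) = closure(⋃_{n=1}^∞ (B ∩ Iₙ)). -/
/-- If `g = w * g + i` with `i ∈ J`, `J` closed and `‖w‖ < 1`, then `g ∈ J`. -/
lemma mem_of_contract {A : Type*} [NonUnitalCStarAlgebra A] (J : TwoSidedIdeal A)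
    (hJ : IsClosed (J : Set A)) (g w : A) (hw : ‖w‖ < 1) (h : g - w * g ∈ J) : g ∈ J := by
  let u : ℕ → A := fun k => (fun z => w * z)^[k] g
  have hsucc : ∀ k, u (k + 1) = w * u k := fun k => by
    simp only [u, Function.iterate_succ_apply']
  have hmem : ∀ k, g - u k ∈ J := by
    intro k
    induction k with
    | zero => simpa [u] using J.zero_mem
    | succ k ih =>
      have := J.add_mem h (J.mul_mem_left w _ ih)
      rw [hsucc]
      convert this using 1
      rw [mul_sub]; abel
  have hnorm : ∀ k, ‖u k‖ ≤ ‖w‖ ^ k * ‖g‖ := by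
    intro k
    induction k with
    | zero => simp [u]
    | succ k ih =>
      rw [hsucc, pow_succ', mul_assoc]
      exact (norm_mul_le _ _).trans (mul_le_mul_of_nonneg_left ih (norm_nonneg _))
  have hu : Filter.Tendsto u Filter.atTop (nhds 0) := by
    refine squeeze_zero_norm hnorm ?_
    simpa using (tendsto_pow_atTop_nhds_zero_of_lt_one (norm_nonneg w) hw).mul_const ‖g‖
  have hlim : Filter.Tendsto (fun k => g - u k) Filter.atTop (nhds g) := by
    simpa using hu.const_sub g
  exact hJ.mem_of_tendsto hlim (Filter.Eventually.of_forall hmem)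

/-- Approximation of `b` by an element of `B ∩ J`. -/
lemma approx_mem {A : Type*} [NonUnitalCStarAlgebra A]
    (B : NonUnitalStarSubalgebra ℂ A) (hB : IsClosed (B : Set A))
    (J : TwoSidedIdeal A) (hJ : IsClosed (J : Set A)) (b x : A) (hb : b ∈ B) (hx : x ∈ J)
    (s : ℝ) (hs : 0 < s) (hbx : ‖b‖ * ‖b - x‖ < s) :
    ∃ c ∈ B, c ∈ J ∧ ‖b - c‖ * ‖b - c‖ ≤ 2 * s := by
  let g : ℝ → ℝ := fun t => min 1 (max 0 (|t| / s - 1))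
  let h : ℝ → ℝ := fun t => t / max (t ^ 2) (s ^ 2)
  have hgc : Continuous g := by fun_prop
  have hpos : ∀ t : ℝ, 0 < max (t ^ 2) (s ^ 2) := fun t => lt_max_of_lt_right (by positivity)
  have hhc : Continuous h :=
    continuous_id.div (by fun_prop) (fun t => (hpos t).ne')
  have hg0 : g 0 = 0 := by simp [g]
  have hh0 : h 0 = 0 := by simp [h]
  have key : ∀ t, h t * t * g t = g t := by
    intro t
    rcases le_total |t| s with hts | hts
    · have : g t = 0 := by
        have : |t| / s ≤ 1 := (div_le_one hs).2 hts
        simp only [g]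
        rw [max_eq_left (by linarith)]
        simp
      simp [this]
    · have h1 : s ^ 2 ≤ t ^ 2 := by
        rw [← sq_abs t]; gcongr
      have ht : t ≠ 0 := by
        rintro rfl
        simp at hts; linarith
      have : h t * t = 1 := by
        simp only [h]
        rw [max_eq_left h1]
        field_simp
      rw [this, one_mul]
  have hhb : ∀ t, ‖h t‖ ≤ 1 / s := by
    intro t
    simp only [h, norm_div, Real.norm_eq_abs, abs_of_pos (hpos t)]
    rw [div_le_div_iff₀ (hpos t) hs, one_mul]
    rcases le_total |t| s with hts | hts
    · refine le_trans ?_ (le_max_right _ _)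
      nlinarith
    · refine le_trans ?_ (le_max_left _ _)
      rw [← sq_abs t]
      nlinarith
  have hgb : ∀ t, ‖t - t * g t - g t * (t - t * g t)‖ ≤ 2 * s := by
    intro t
    have e : t - t * g t - g t * (t - t * g t) = t * (1 - g t) ^ 2 := by ring
    rw [e, norm_mul, Real.norm_eq_abs, Real.norm_eq_abs, abs_of_nonneg (sq_nonneg (1 - g t))]
    have g0 : 0 ≤ g t := le_min zero_le_one (le_max_left _ _)
    have g1 : g t ≤ 1 := min_le_left _ _
    rcases le_total |t| (2 * s) with hts | hts
    · have : (1 - g t) ^ 2 ≤ 1 := by nlinarith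
      nlinarith [abs_nonneg t]
    · have : g t = 1 := by
        have h2 : 2 ≤ |t| / s := (le_div_iff₀ hs).2 hts
        simp only [g]
        exact min_eq_left (le_max_of_le_right (by linarith))
      rw [this]; simp; exact hs.le
  set a : A := star b * b with ha
  have hsa : IsSelfAdjoint a := IsSelfAdjoint.star_mul_self b
  have haB : a ∈ B := mul_mem (star_mem hb) hb
  have hid : cfcₙ (fun t : ℝ => t) a = a := cfcₙ_id' ℝ a
  have hGB : cfcₙ g a ∈ B := by
    have : IsClosed (B : Set A) := hB
    exact cfcₙ_mem (𝕜' := ℂ) g haB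
  have hGsa : star (cfcₙ g a) = cfcₙ g a := (cfcₙ_predicate g a : IsSelfAdjoint _)
  have hkey : cfcₙ h a * a * cfcₙ g a = cfcₙ g a := by
    have e1 : cfcₙ (fun t => h t * t) a = cfcₙ h a * a := by
      rw [cfcₙ_mul h (fun t => t) a (by fun_prop) hh0 (by fun_prop) (by simp), hid]
    rw [← e1, ← cfcₙ_mul (fun t => h t * t) g a (by fun_prop) (by simp) (by fun_prop) hg0]
    simp only [key]
  have hGJ : cfcₙ g a ∈ J := by
    refine mem_of_contract J hJ _ (cfcₙ h a * (a - star b * x)) ?_ ?_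
    · have h1 : ‖cfcₙ h a‖ ≤ 1 / s := norm_cfcₙ_le fun t _ => hhb t
      have h2 : ‖a - star b * x‖ < s := by
        rw [ha, ← mul_sub]
        refine (norm_mul_le _ _).trans_lt ?_
        rwa [norm_star]
      refine (norm_mul_le _ _).trans_lt ?_
      calc ‖cfcₙ h a‖ * ‖a - star b * x‖ ≤ 1 / s * ‖a - star b * x‖ := by gcongr
        _ < 1 / s * s := by gcongr
        _ = 1 := by field_simp
    · have : cfcₙ g a - cfcₙ h a * (a - star b * x) * cfcₙ g a
          = cfcₙ h a * (star b * x) * cfcₙ g a := by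
        rw [mul_sub, sub_mul, hkey]; abel
      rw [this]
      exact J.mul_mem_right _ _ (J.mul_mem_left _ _ (J.mul_mem_left _ _ hx))
  refine ⟨b * cfcₙ g a, mul_mem hb hGB, J.mul_mem_left _ _ hGJ, ?_⟩
  rw [← CStarRing.norm_star_mul_self]
  have : star (b - b * cfcₙ g a) * (b - b * cfcₙ g a)
      = cfcₙ (fun t => t - t * g t - g t * (t - t * g t)) a := by
    rw [cfcₙ_sub (fun t => t - t * g t) (fun t => g t * (t - t * g t)) a (by fun_prop) (by simp)
      (by fun_prop) (by simp),
      cfcₙ_mul g (fun t => t - t * g t) a (by fun_prop) hg0 (by fun_prop) (by simp),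
      cfcₙ_sub (fun t => t) (fun t => t * g t) a (by fun_prop) (by simp) (by fun_prop) (by simp),
      cfcₙ_mul (fun t => t) g a (by fun_prop) (by simp) (by fun_prop) hg0, hid]
    rw [star_sub, star_mul, hGsa, ha]
    noncomm_ring
  rw [this]
  exact norm_cfcₙ_le fun t _ => hgb t

/-- Let `A` be a C*-algebra, `B ⊆ A` a C*-subalgebra (closed *-subalgebra),
and `I₁ ⊆ I₂ ⊆ ⋯` an increasing sequence of closed two-sided ideals of `A`. Then
`B ∩ closure (⋃ n, Iₙ) = closure (⋃ n, (B ∩ Iₙ))`. -/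
theorem stmt_0 {A : Type*} [NonUnitalCStarAlgebra A]
    (B : NonUnitalStarSubalgebra ℂ A) (hB : IsClosed (B : Set A))
    (I : ℕ → TwoSidedIdeal A) (hIclosed : ∀ n, IsClosed ((I n : Set A)))
    (hImono : Monotone I) :
    (B : Set A) ∩ closure (⋃ n, (I n : Set A)) =
      closure (⋃ n, ((B : Set A) ∩ (I n : Set A))) := by
  apply Set.Subset.antisymm
  · rintro b ⟨hb, hbI⟩
    rw [Metric.mem_closure_iff] at hbI ⊢
    intro ε hε
    obtain ⟨x, hx, hd⟩ := hbI (ε ^ 2 / 4 / (‖b‖ + 1)) (by positivity)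
    obtain ⟨n, hn⟩ := Set.mem_iUnion.1 hx
    rw [dist_eq_norm, lt_div_iff₀ (by positivity)] at hd
    obtain ⟨c, hcB, hcI, hc⟩ := approx_mem B hB (I n) (hIclosed n) b x hb hn (ε ^ 2 / 4)
      (by positivity) (by nlinarith [norm_nonneg (b - x)])
    refine ⟨c, Set.mem_iUnion.2 ⟨n, hcB, hcI⟩, ?_⟩
    rw [dist_eq_norm]
    by_contra hlt
    push Not at hlt
    nlinarith [norm_nonneg (b - c)]
  · refine Set.subset_inter ?_ ?_
    · exact closure_minimal (Set.iUnion_subset fun n => Set.inter_subset_left) hB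
    · exact closure_mono (Set.iUnion_mono fun n => Set.inter_subset_right)
end

section
/- Let n ∈ ℕ, let B be a C*-algebra, let β be a *-automorphism of B with β^(2^n) = id_B, let I ⊆ B be a closed two-sided ideal with β(I) = I, let π : B → B/I be the quotient map, and let α be the automorphism of B/I induced by β (so α(π(b)) = π(β(b)) for all b ∈ B). If x ∈ B/I is selfadjoint and satisfies α(x) = −x, then there exists a selfadjoint element y ∈ B such that β(y) = −y and π(y) = x. -/
/-- Let `n ∈ ℕ`, `B` a C*-algebra, `β` a *-automorphism of `B` with
`β^(2^n) = id`. Let `π : B → C` be a surjective *-homomorphism onto a C*-algebra `C`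
(playing the role of the quotient map `B → B/I` by the β-invariant closed two-sided
ideal `I = ker π`), and let `α` be the *-automorphism of `C` induced by `β`, i.e.
`α (π b) = π (β b)` for all `b`. If `x ∈ C` is selfadjoint and `α x = -x`, then there
is a selfadjoint `y ∈ B` with `β y = -y` and `π y = x`. -/
theorem stmt_1 {B C : Type*} [NonUnitalCStarAlgebra B] [NonUnitalCStarAlgebra C]
    (n : ℕ) (β : B ≃⋆ₐ[ℂ] B) (hβ : (⇑β)^[2 ^ n] = id)
    (π : B →⋆ₙₐ[ℂ] C) (hπ : Function.Surjective π)
    (α : C ≃⋆ₐ[ℂ] C) (hcomm : ∀ b : B, α (π b) = π (β b))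
    (x : C) (hx : IsSelfAdjoint x) (hαx : α x = -x) :
    ∃ y : B, IsSelfAdjoint y ∧ β y = -y ∧ π y = x := by
  obtain ⟨b₀, hb₀⟩ := hπ x
  rcases Nat.eq_zero_or_pos n with h0 | hn
  · subst h0
    have hid : ∀ b, β b = b := fun b => by
      have := congrFun hβ b
      simpa using this
    refine ⟨0, IsSelfAdjoint.zero _, by simp, ?_⟩
    have h1 : x = -x := by
      rw [← hαx, ← hb₀, hcomm, hid]
    rw [map_zero]
    have h2 : (2 : ℂ) • x = 0 := by
      rw [two_smul]
      nth_rewrite 2 [h1]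
      simp
    rcases smul_eq_zero.mp h2 with h | h
    · norm_num at h
    · exact h.symm
  -- a selfadjoint lift
  obtain ⟨b, hb, hbx⟩ : ∃ b : B, star b = b ∧ π b = x := by
    refine ⟨(2⁻¹ : ℂ) • (b₀ + star b₀), ?_, ?_⟩
    · simp [star_smul, add_comm]
    · rw [map_smul, map_add, map_star, hb₀, hx.star_eq, ← two_smul ℂ x, smul_smul]
      norm_num
  -- the alternating average
  let f : ℕ → B := fun k => (-1 : ℂ) ^ k • (⇑β)^[k] b
  have hfs : ∀ k, β (f k) = -f (k + 1) := fun k => by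
    simp only [f, map_smul, Function.iterate_succ_apply', pow_succ]
    simp
  have hf0 : f 0 = b := by simp [f]
  have hfN : f (2 ^ n) = b := by
    have he : Even (2 ^ n) := (Nat.even_pow.mpr ⟨even_two, hn.ne'⟩)
    simp only [f, hβ, he.neg_one_pow]
    simp
  have hfstar : ∀ k, star (f k) = f k := fun k => by
    induction k with
    | zero => rw [hf0, hb]
    | succ k ih =>
      have : f (k + 1) = -β (f k) := by rw [hfs, neg_neg]
      rw [this, star_neg, ← map_star, ih]
  have hfx : ∀ k, π (f k) = x := fun k => by
    induction k with
    | zero => rw [hf0, hbx]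
    | succ k ih =>
      have : f (k + 1) = -β (f k) := by rw [hfs, neg_neg]
      rw [this, map_neg, ← hcomm, ih, hαx, neg_neg]
  have hshift : ∑ k ∈ Finset.range (2 ^ n), f (k + 1) = ∑ k ∈ Finset.range (2 ^ n), f k := by
    have h1 := Finset.sum_range_succ f (2 ^ n)
    rw [Finset.sum_range_succ', hf0, hfN] at h1
    exact add_right_cancel h1
  refine ⟨((2 ^ n : ℂ))⁻¹ • ∑ k ∈ Finset.range (2 ^ n), f k, ?_, ?_, ?_⟩
  · rw [IsSelfAdjoint, star_smul, star_sum]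
    simp [hfstar]
  · rw [map_smul, map_sum]
    simp only [hfs, Finset.sum_neg_distrib, hshift, smul_neg]
  · rw [map_smul, map_sum]
    simp only [hfx, Finset.sum_const, Finset.card_range]
    rw [← Nat.cast_smul_eq_nsmul ℂ, smul_smul]
    simp
end

section
/- Let n ∈ ℕ, let B be a C*-algebra, let β be a *-automorphism of B with β^(2^n) = id_B, let I ⊆ B be a closed two-sided ideal with β(I) = I, let π : B → B/I be the quotient map, and let α be the automorphism of B/I induced by β (so α(π(b)) = π(β(b)) for all b ∈ B). Let h₁, h₂ ∈ B/I be positive elements with h₁h₂ = 0, α(h₁) = h₂, and α(h₂) = h₁. Then there exist positive elements k₁, k₂ ∈ B with k₁k₂ = 0, π(k₁) = h₁, π(k₂) = h₂, β(k₁) = k₂, and β(k₂) = k₁. -/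
lemma jordan_exists {A : Type*} [NonUnitalCStarAlgebra A] (x : A) (hx : IsSelfAdjoint x) :
    ∃ b c : A, x = star b * b - star c * c ∧ (star b * b) * (star c * c) = 0 ∧
      (star c * c) * (star b * b) = 0 := by
  let _ := CStarAlgebra.spectralOrder A
  have := CStarAlgebra.spectralOrderedRing A
  obtain ⟨b, hb⟩ := CStarAlgebra.nonneg_iff_eq_star_mul_self.mp (CFC.posPart_nonneg x)
  obtain ⟨c, hc⟩ := CStarAlgebra.nonneg_iff_eq_star_mul_self.mp (CFC.negPart_nonneg x)
  refine ⟨b, c, ?_, ?_, ?_⟩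
  · rw [← hb, ← hc, CFC.posPart_sub_negPart x hx]
  · rw [← hb, ← hc, CFC.posPart_mul_negPart]
  · rw [← hb, ← hc, CFC.negPart_mul_posPart]

lemma jordan_unique {A : Type*} [NonUnitalCStarAlgebra A] (b c d e : A)
    (hb : ∃ y, b = star y * y) (hc : ∃ y, c = star y * y)
    (hd : ∃ y, d = star y * y) (he : ∃ y, e = star y * y)
    (hbc : b * c = 0) (hde : d * e = 0) (h : b - c = d - e) : b = d ∧ c = e := by
  let _ := CStarAlgebra.spectralOrder A
  have := CStarAlgebra.spectralOrderedRing A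
  have h1 := CFC.posPart_negPart_unique (a := b - c) rfl hbc
    (CStarAlgebra.nonneg_iff_eq_star_mul_self.mpr hb)
    (CStarAlgebra.nonneg_iff_eq_star_mul_self.mpr hc)
  have h2 := CFC.posPart_negPart_unique (a := b - c) h hde
    (CStarAlgebra.nonneg_iff_eq_star_mul_self.mpr hd)
    (CStarAlgebra.nonneg_iff_eq_star_mul_self.mpr he)
  exact ⟨h1.1.symm.trans h2.1, h1.2.symm.trans h2.2⟩


/-- Let `n ∈ ℕ`, `B` a C*-algebra, `β` a *-automorphism of `B` with
`β^(2^n) = id`. Let `π : B → C` be a surjective *-homomorphism onto a C*-algebra `C`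
(the quotient map by the β-invariant closed two-sided ideal `I = ker π`), and let `α`
be the induced *-automorphism of `C`, i.e. `α (π b) = π (β b)`. Let `h₁, h₂ ∈ C` be
positive (i.e. of the form `star c * c`) orthogonal elements with `α h₁ = h₂` and
`α h₂ = h₁`. Then there are positive orthogonal `k₁, k₂ ∈ B` with `π k₁ = h₁`,
`π k₂ = h₂`, `β k₁ = k₂`, `β k₂ = k₁`. -/
theorem stmt_2 {B C : Type*} [NonUnitalCStarAlgebra B] [NonUnitalCStarAlgebra C]
    (n : ℕ) (β : B ≃⋆ₐ[ℂ] B) (hβ : (⇑β)^[2 ^ n] = id)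
    (π : B →⋆ₙₐ[ℂ] C) (hπ : Function.Surjective π)
    (α : C ≃⋆ₐ[ℂ] C) (hcomm : ∀ b : B, α (π b) = π (β b))
    (h₁ h₂ : C) (hpos₁ : ∃ c : C, h₁ = star c * c) (hpos₂ : ∃ c : C, h₂ = star c * c)
    (horth : h₁ * h₂ = 0) (hα₁ : α h₁ = h₂) (hα₂ : α h₂ = h₁) :
    ∃ k₁ k₂ : B, (∃ b : B, k₁ = star b * b) ∧ (∃ b : B, k₂ = star b * b) ∧
      k₁ * k₂ = 0 ∧ π k₁ = h₁ ∧ π k₂ = h₂ ∧ β k₁ = k₂ ∧ β k₂ = k₁ := by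

  have sa₁ : star h₁ = h₁ := by obtain ⟨c, rfl⟩ := hpos₁; simp
  have sa₂ : star h₂ = h₂ := by obtain ⟨c, rfl⟩ := hpos₂; simp
  rcases Nat.eq_zero_or_pos n with rfl | hn
  · have hid : ∀ b, β b = b := fun b => by simpa using congrFun hβ b
    have h12 : h₁ = h₂ := by
      obtain ⟨b, rfl⟩ := hπ h₁
      rw [← hα₁, hcomm, hid]
    subst h12
    have h0 : h₁ = 0 := by
      rw [← CStarRing.star_mul_self_eq_zero_iff, sa₁, horth]
    subst h0
    exact ⟨0, 0, ⟨0, by simp⟩, ⟨0, by simp⟩, by simp, by simp, by simp, by simp, by simp⟩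
  -- a lift of `h₁ - h₂` which is anti-invariant
  have hlift : ∃ y : B, β y = -y ∧ π y = h₁ - h₂ := by
    obtain ⟨x, hx⟩ := hπ (h₁ - h₂)
    let f : ℕ → B := fun j => (-1 : ℂ) ^ j • (⇑β)^[j] x
    have hf : ∀ j, β (f j) = -f (j + 1) := fun j => by
      simp only [f, map_smul, Function.iterate_succ_apply', pow_succ]
      simp
    have hf0 : f (2 ^ n) = f 0 := by
      have he : Even (2 ^ n) := (Nat.even_pow.mpr ⟨even_two, hn.ne'⟩)
      simp [f, hβ, he.neg_one_pow]
    have hpf : ∀ j, π (f j) = h₁ - h₂ := fun j => by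
      induction j with
      | zero => simpa [f] using hx
      | succ j ih =>
        have : f (j + 1) = -β (f j) := by rw [hf, neg_neg]
        rw [this, map_neg, ← hcomm, ih, map_sub, hα₁, hα₂, neg_sub]
    refine ⟨((2 ^ n : ℕ) : ℂ)⁻¹ • ∑ j ∈ Finset.range (2 ^ n), f j, ?_, ?_⟩
    · rw [map_smul, map_sum, ← smul_neg]
      congr 1
      simp only [hf, Finset.sum_neg_distrib]
      congr 1
      have h1 := Finset.sum_range_succ f (2 ^ n)
      rw [Finset.sum_range_succ', hf0] at h1
      exact add_right_cancel h1
    · rw [map_smul, map_sum]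
      simp only [hpf, Finset.sum_const, Finset.card_range]
      rw [← Nat.cast_smul_eq_nsmul ℂ, smul_smul, inv_mul_cancel₀ (by simp), one_smul]
  obtain ⟨y, hy, hpy⟩ := hlift
  let x : B := (2 : ℂ)⁻¹ • (y + star y)
  have hxsa : IsSelfAdjoint x := by
    simp [x, IsSelfAdjoint, star_smul, add_comm]
  have hβx : β x = -x := by
    simp only [x, map_smul, map_add, map_star, hy, star_neg]
    rw [← smul_neg, neg_add]
  have hπx : π x = h₁ - h₂ := by
    simp only [x, map_smul, map_add, map_star, hpy, star_sub, sa₁, sa₂]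
    rw [← two_smul ℂ, smul_smul, inv_mul_cancel₀ two_ne_zero, one_smul]
  obtain ⟨b, c, hx, hbc, hcb⟩ := jordan_exists x hxsa
  have key := jordan_unique (β (star b * b)) (β (star c * c)) (star c * c) (star b * b)
    ⟨β b, by simp [map_star]⟩ ⟨β c, by simp [map_star]⟩ ⟨c, rfl⟩ ⟨b, rfl⟩
    (by rw [← map_mul, hbc, map_zero]) hcb (by rw [← map_sub, ← hx, hβx, hx, neg_sub])
  have key2 := jordan_unique (π (star b * b)) (π (star c * c)) h₁ h₂
    ⟨π b, by simp [map_star]⟩ ⟨π c, by simp [map_star]⟩ hpos₁ hpos₂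
    (by rw [← map_mul, hbc, map_zero]) horth (by rw [← map_sub, ← hx, hπx])
  exact ⟨_, _, ⟨b, rfl⟩, ⟨c, rfl⟩, hbc, key2.1, key2.2, key.1, key.2⟩
end

section
/- Let n ∈ ℕ, let B be a C*-algebra, let β be a *-automorphism of B with β^(2^n) = id_B, let I ⊆ B be a closed two-sided ideal with β(I) = I, let π : B → B/I be the quotient map, and let α be the automorphism of B/I induced by β. Let h₁, h₂, …, h_{2^n} ∈ B/I be positive elements with hᵢhⱼ = 0 for i ≠ j, α(h_m) = h_{m+1} for m = 1, …, 2^n − 1, and α(h_{2^n}) = h₁. Then there exist positive elements k₁, …, k_{2^n} ∈ B with kᵢkⱼ = 0 for i ≠ j, π(k_m) = h_m for all m, β(k_m) = k_{m+1} for m = 1, …, 2^n − 1, and β(k_{2^n}) = k₁. Moreover, if ‖h_m‖ ≤ 1 for all m, then one can choose the k_m with ‖k_m‖ ≤ 1 for all m. -/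
namespace Stmt3Aux

section A
variable {A : Type*} [NonUnitalCStarAlgebra A]

lemma cancel {c y : A} (hc : IsSelfAdjoint c) (h : c * (c * y) = 0) : c * y = 0 := by
  have : star (c * y) * (c * y) = 0 := by
    rw [star_mul, hc.star_eq, mul_assoc, h, mul_zero]
  exact CStarRing.star_mul_self_eq_zero_iff _ |>.mp this

lemma cancel_right {c y : A} (hc : IsSelfAdjoint c) (h : y * c * c = 0) : y * c = 0 := by
  have h' := congrArg star h
  simp only [star_mul, hc.star_eq, star_zero] at h'
  have := congrArg star (cancel hc h')
  simpa [hc.star_eq] using this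

lemma orth_iter (b : A →⋆ₙₐ[ℂ] A) {e : A} (he : IsSelfAdjoint e) {D : ℕ}
    (h : ∀ i, ¬ D ∣ i → e * (b ^ i) e = 0) (s t : ℕ) (hst : ¬ s ≡ t [MOD D]) :
    (b ^ s) e * (b ^ t) e = 0 := by
  have key : ∀ s t : ℕ, s ≤ t → ¬ s ≡ t [MOD D] → (b ^ s) e * (b ^ t) e = 0 := by
    intro s t hle hst
    obtain ⟨r, rfl⟩ := Nat.exists_eq_add_of_le hle
    have hr : ¬ D ∣ r := by
      intro hd
      apply hst
      rw [Nat.modEq_iff_dvd' hle]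
      simpa using hd
    have h1 : (b ^ (s + r)) e = (b ^ s) ((b ^ r) e) := by rw [pow_add]; rfl
    rw [h1, ← map_mul, h r hr, map_zero]
  rcases le_total s t with hle | hle
  · exact key s t hle hst
  · have h1 := congrArg star (key t s hle (fun h => hst h.symm))
    simpa [← map_star, he.star_eq] using h1

variable [PartialOrder A] [StarOrderedRing A]

lemma map_pos {A' : Type*} [NonUnitalCStarAlgebra A'] [PartialOrder A'] [StarOrderedRing A']
    (f : A →⋆ₙₐ[ℂ] A') {x : A} (hx : 0 ≤ x) : 0 ≤ f x := by
  obtain ⟨y, rfl⟩ := CStarAlgebra.nonneg_iff_eq_star_mul_self.mp hx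
  rw [map_mul, map_star]
  exact star_mul_self_nonneg _

lemma map_posPart {A' : Type*} [NonUnitalCStarAlgebra A'] [PartialOrder A'] [StarOrderedRing A']
    (f : A →⋆ₙₐ[ℂ] A') {d : A} (hd : IsSelfAdjoint d) : f (d⁺) = (f d)⁺ := by
  refine (CFC.posPart_negPart_unique (a := f d) (b := f (d⁺)) (c := f (d⁻)) ?_ ?_ ?_ ?_).1.symm
  · rw [← map_sub, CFC.posPart_sub_negPart d hd]
  · rw [← map_mul, CFC.posPart_mul_negPart, map_zero]
  · exact map_pos f (CFC.posPart_nonneg d)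
  · exact map_pos f (CFC.negPart_nonneg d)

lemma posPart_orth {d d' : A} (hd : IsSelfAdjoint d) (hd' : IsSelfAdjoint d') (h : d * d' = 0) :
    d⁺ * d'⁺ = 0 := by
  have h1 : d⁺ * d⁺ = d⁺ * d := by
    have h0 := congrArg (fun z => d⁺ * z) (CFC.posPart_sub_negPart d hd)
    simpa only [mul_sub, CFC.posPart_mul_negPart, sub_zero] using h0
  have h2 : d'⁺ * d'⁺ = d' * d'⁺ := by
    have h0 := congrArg (fun z => z * d'⁺) (CFC.posPart_sub_negPart d' hd')
    simpa only [sub_mul, CFC.negPart_mul_posPart, sub_zero] using h0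
  have s1 : IsSelfAdjoint (d⁺) := .of_nonneg (CFC.posPart_nonneg d)
  have s2 : IsSelfAdjoint (d'⁺) := .of_nonneg (CFC.posPart_nonneg d')
  apply cancel s1
  rw [← mul_assoc]
  apply cancel_right s2
  rw [h1, mul_assoc, h2, mul_assoc, ← mul_assoc d, h, zero_mul, mul_zero]

lemma exists_root4 {x : A} (hx : 0 ≤ x) : ∃ c : A, 0 ≤ c ∧ x = c * (c * (c * c)) := by
  refine ⟨CFC.sqrt (CFC.sqrt x), CFC.sqrt_nonneg _, ?_⟩
  rw [← mul_assoc, CFC.sqrt_mul_sqrt_self _ (CFC.sqrt_nonneg _), CFC.sqrt_mul_sqrt_self _ hx]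

end A

section main
variable {B C : Type*} [NonUnitalCStarAlgebra B] [NonUnitalCStarAlgebra C]
  [PartialOrder B] [StarOrderedRing B] [PartialOrder C] [StarOrderedRing C]

lemma sum_orth {A : Type*} [NonUnitalCStarAlgebra A] (b : A →⋆ₙₐ[ℂ] A) {e : A}
    (he : IsSelfAdjoint e) {D E : ℕ} (hDE : D ∣ E) (M : ℕ)
    (h : ∀ i, ¬ D ∣ i → e * (b ^ i) e = 0) (s t : ℕ) (hst : ¬ s ≡ t [MOD D]) :
    (b ^ s) (∑ j ∈ Finset.range M, (b ^ (E * j)) e) *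
      (b ^ t) (∑ j ∈ Finset.range M, (b ^ (E * j)) e) = 0 := by
  rw [map_sum, map_sum, Finset.sum_mul_sum]
  refine Finset.sum_eq_zero fun j _ => Finset.sum_eq_zero fun k _ => ?_
  have h1 : (b ^ s) ((b ^ (E * j)) e) = (b ^ (s + E * j)) e := by rw [pow_add]; rfl
  have h2 : (b ^ t) ((b ^ (E * k)) e) = (b ^ (t + E * k)) e := by rw [pow_add]; rfl
  rw [h1, h2]
  refine orth_iter b he h _ _ fun hc => hst ?_
  obtain ⟨F, rfl⟩ := hDE
  simpa [Nat.ModEq, mul_assoc] using hc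

lemma step (b : B →⋆ₙₐ[ℂ] B) (a : C →⋆ₙₐ[ℂ] C) (π : B →⋆ₙₐ[ℂ] C)
    (hcomm : ∀ (i : ℕ) x, π ((b ^ i) x) = (a ^ i) (π x)) (D M : ℕ) (hD : 0 < D)
    (hb : b ^ (2 * D * M) = 1) (hM : 0 < M)
    {c : C} (hc : 0 ≤ c) (hco : ∀ i, ¬ (2 * D * M) ∣ i → c * (a ^ i) c = 0)
    {e : B} (he : 0 ≤ e) (hec : π e = c) (heo : ∀ i, ¬ D ∣ i → e * (b ^ i) e = 0) :
    ∃ k : B, 0 ≤ k ∧ π k = c * (c * (c * c)) ∧ ∀ i, ¬ (2 * D) ∣ i → k * (b ^ i) k = 0 := by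
  have hes : IsSelfAdjoint e := .of_nonneg he
  have hcs : IsSelfAdjoint c := .of_nonneg hc
  set g : B := ∑ j ∈ Finset.range M, (b ^ (2 * D * j)) e with hg
  have hg0 : 0 ≤ g := Finset.sum_nonneg fun j _ => map_pos _ he
  have hgs : IsSelfAdjoint g := .of_nonneg hg0
  set p : C := ∑ j ∈ Finset.range M, (a ^ (2 * D * j)) c with hp
  have hp0 : 0 ≤ p := Finset.sum_nonneg fun j _ => map_pos _ hc
  have hπg : π g = p := by
    rw [hg, map_sum]
    exact Finset.sum_congr rfl fun j _ => by rw [hcomm, hec]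
  have hbg : (b ^ (2 * D)) g = g := by
    have h1 := Finset.sum_range_succ' (fun j => (b ^ (2 * D * j)) e) M
    rw [Finset.sum_range_succ, hb] at h1
    have h2 : (b ^ (2 * D)) g = ∑ j ∈ Finset.range M, (b ^ (2 * D * (j + 1))) e := by
      rw [hg, map_sum]
      refine Finset.sum_congr rfl fun j _ => ?_
      rw [mul_add, mul_one, add_comm, pow_add]; rfl
    rw [h2]
    simpa using h1.symm
  set d : B := g - (b ^ D) g with hd
  have hds : IsSelfAdjoint d := hgs.sub (hgs.map (b ^ D))
  have hbd : (b ^ D) d = -d := by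
    have : (b ^ D) ((b ^ D) g) = (b ^ (2 * D)) g := by rw [two_mul, pow_add]; rfl
    rw [hd, map_sub, this, hbg]; abel
  have hbdl : ∀ l, (b ^ (2 * D * l)) d = d := by
    intro l
    induction l with
    | zero => simp
    | succ l ih =>
      have : (b ^ (2 * D * (l + 1))) d = (b ^ (2 * D * l)) ((b ^ D) ((b ^ D) d)) := by
        rw [show 2 * D * (l + 1) = 2 * D * l + (D + D) by ring, pow_add, pow_add]; rfl
      rw [this, hbd, map_neg, hbd, neg_neg, ih]
  have hdd : ∀ i, ¬ D ∣ i → d * (b ^ i) d = 0 := by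
    intro i hi
    have hDE : D ∣ 2 * D := Dvd.intro_left 2 rfl
    have hi' : ¬ (0 ≡ i [MOD D]) := fun h => hi ((Nat.modEq_zero_iff_dvd).mp h.symm)
    have e0 : (b ^ 0) g = g := by simp
    have e1 : (b ^ i) ((b ^ D) g) = (b ^ (i + D)) g := by rw [pow_add]; rfl
    have o := sum_orth b hes hDE M heo
    have o1 := o 0 i hi'
    have o2 := o 0 (i + D) (by simpa [Nat.ModEq] using hi')
    have o3 := o D i (by simpa [Nat.ModEq] using hi')
    have o4 := o D (i + D) (by simpa [Nat.ModEq] using hi')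
    rw [← hg, e0] at o1 o2
    rw [← hg] at o3 o4
    rw [hd, map_sub, e1, sub_mul, mul_sub, mul_sub, o1, o2, o3, o4]
    simp
  have hdp : ∀ i, ¬ (2 * D) ∣ i → d⁺ * (b ^ i) (d⁺) = 0 := by
    intro i hi
    rw [map_posPart _ hds]
    by_cases hDi : D ∣ i
    · have : (b ^ i) d = -d := by
        obtain ⟨l, rfl⟩ := hDi
        rcases Nat.even_or_odd' l with ⟨r, rfl | rfl⟩
        · exact absurd ⟨r, by ring⟩ hi
        · have : (b ^ (D * (2 * r + 1))) d = (b ^ (2 * D * r)) ((b ^ D) d) := by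
            rw [show D * (2 * r + 1) = 2 * D * r + D by ring, pow_add]; rfl
          rw [this, hbd, map_neg, hbdl]
      rw [this, CFC.posPart_neg, CFC.posPart_mul_negPart]
    · exact posPart_orth hds (hds.map (b ^ i)) (hdd i hDi)
  have hds' : IsSelfAdjoint (d⁺) := .of_nonneg (CFC.posPart_nonneg d)
  have hoc := orth_iter a hcs hco
  have hπd : π (d⁺) = p := by
    rw [map_posPart _ hds]
    refine (CFC.posPart_negPart_unique (a := π d) (b := p) (c := (a ^ D) p) ?_ ?_ hp0
      (map_pos _ hp0)).1
    · rw [hd, map_sub, hcomm, hπg]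
    · rw [hp, map_sum, Finset.sum_mul_sum]
      refine Finset.sum_eq_zero fun j _ => Finset.sum_eq_zero fun k _ => ?_
      have h2 : (a ^ D) ((a ^ (2 * D * k)) c) = (a ^ (D + 2 * D * k)) c := by rw [pow_add]; rfl
      rw [h2]
      refine hoc _ _ fun h => ?_
      have h3 : 2 * D * j ≡ D + 2 * D * k [MOD 2 * D] := h.of_dvd (Dvd.intro _ rfl)
      have h4 : 0 = D % (2 * D) := by simpa [Nat.ModEq] using h3
      rw [Nat.mod_eq_of_lt (by omega)] at h4
      omega
  have hpc : p * c = c * c := by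
    rw [hp, Finset.sum_mul, Finset.sum_eq_single 0]
    · simp
    · intro j hj hj0
      have := hoc (2 * D * j) 0 (by
        intro h
        rw [Nat.modEq_zero_iff_dvd] at h
        have h5 : M ∣ j := Nat.dvd_of_mul_dvd_mul_left (by omega) h
        have := Nat.le_of_dvd (by omega) h5
        have := Finset.mem_range.mp hj
        omega)
      simpa using this
    · intro h
      exact absurd (Finset.mem_range.mpr hM) h
  have hcp : c * p = c * c := by
    have := congrArg star hpc
    simpa [hcs.star_eq, (IsSelfAdjoint.of_nonneg hp0).star_eq] using this
  refine ⟨d⁺ * (e * (e * d⁺)), ?_, ?_, ?_⟩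
  · have : d⁺ * (e * (e * d⁺)) = star (e * d⁺) * (e * d⁺) := by
      rw [star_mul, hds'.star_eq, hes.star_eq, mul_assoc]
    rw [this]
    exact star_mul_self_nonneg _
  · rw [map_mul, map_mul, map_mul, hπd, hec, hcp, ← mul_assoc, hpc, mul_assoc]
  · intro i hi
    simp only [map_mul]
    have := hdp i hi
    simp only [mul_assoc]
    rw [← mul_assoc (d⁺) ((b ^ i) (d⁺)), this]
    simp

lemma lift_all (b : B →⋆ₙₐ[ℂ] B) (a : C →⋆ₙₐ[ℂ] C) (π : B →⋆ₙₐ[ℂ] C)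
    (hπ : Function.Surjective π)
    (hcomm : ∀ (i : ℕ) x, π ((b ^ i) x) = (a ^ i) (π x)) (n : ℕ) (hb : b ^ (2 ^ n) = 1) (m : ℕ)
    (hm : m ≤ n) (x : C) (hx : 0 ≤ x) (hxo : ∀ i, ¬ 2 ^ n ∣ i → x * (a ^ i) x = 0) :
    ∃ k : B, 0 ≤ k ∧ π k = x ∧ ∀ i, ¬ 2 ^ m ∣ i → k * (b ^ i) k = 0 := by
  induction m generalizing x with
  | zero =>
    obtain ⟨y, rfl⟩ := CStarAlgebra.nonneg_iff_eq_star_mul_self.mp hx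
    obtain ⟨z, rfl⟩ := hπ y
    exact ⟨star z * z, star_mul_self_nonneg z, by simp [map_star], fun i hi => by simp at hi⟩
  | succ m ih =>
    obtain ⟨c, hc, rfl⟩ := exists_root4 hx
    have hcs : IsSelfAdjoint c := .of_nonneg hc
    have hco : ∀ i, ¬ 2 ^ n ∣ i → c * (a ^ i) c = 0 := by
      intro i hi
      have h1 := hxo i hi
      have hs : IsSelfAdjoint ((a ^ i) c) := hcs.map (a ^ i)
      simp only [map_mul] at h1
      generalize (a ^ i) c = c' at h1 hs
      have h2 : c * (c * (c * (c * (c' * (c' * (c' * c')))))) = 0 := by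
        simpa only [mul_assoc] using h1
      have h3 := cancel hcs (cancel hcs (cancel hcs h2))
      have h4 : c * c' * c' * c' * c' = 0 := by simpa only [mul_assoc] using h3
      exact cancel_right hs (cancel_right hs (cancel_right hs h4))
    obtain ⟨e, he, hec, heo⟩ := ih (by omega) c hc hco
    have hn : 2 ^ n = 2 * 2 ^ m * 2 ^ (n - m - 1) := by
      rw [← pow_succ', ← pow_add]; congr 1; omega
    rw [hn] at hb hco
    obtain ⟨k, h1, h2, h3⟩ := step b a π hcomm (2 ^ m) (2 ^ (n - m - 1)) (by positivity) hb
      (by positivity) hc hco he hec heo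
    exact ⟨k, h1, h2, by rwa [pow_succ']⟩

lemma lift_norm (b : B →⋆ₙₐ[ℂ] B) (a : C →⋆ₙₐ[ℂ] C) (π : B →⋆ₙₐ[ℂ] C)
    (hπ : Function.Surjective π)
    (hcomm : ∀ (i : ℕ) x, π ((b ^ i) x) = (a ^ i) (π x)) (n : ℕ) (hb : b ^ (2 ^ n) = 1)
    (x : C) (hx : 0 ≤ x) (hxo : ∀ i, ¬ 2 ^ n ∣ i → x * (a ^ i) x = 0) :
    ∃ k : B, 0 ≤ k ∧ π k = x ∧ (∀ i, ¬ 2 ^ n ∣ i → k * (b ^ i) k = 0) ∧ (‖x‖ ≤ 1 → ‖k‖ ≤ 1) := by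
  by_cases hx1 : ‖x‖ ≤ 1
  swap
  · obtain ⟨k, h1, h2, h3⟩ := lift_all b a π hπ hcomm n hb n le_rfl x hx hxo
    exact ⟨k, h1, h2, h3, fun h => absurd h hx1⟩
  obtain ⟨c, hc, rfl⟩ : ∃ c : C, 0 ≤ c ∧ x = c * c :=
    ⟨CFC.sqrt x, CFC.sqrt_nonneg _, (CFC.sqrt_mul_sqrt_self _ hx).symm⟩
  have hcs : IsSelfAdjoint c := .of_nonneg hc
  have hc1 : ‖c‖ ≤ 1 := by
    have h : ‖star c * c‖ = ‖c‖ * ‖c‖ := CStarRing.norm_star_mul_self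
    rw [hcs.star_eq] at h
    nlinarith [norm_nonneg c]
  have hco : ∀ i, ¬ 2 ^ n ∣ i → c * (a ^ i) c = 0 := by
    intro i hi
    have h1 := hxo i hi
    have hs : IsSelfAdjoint ((a ^ i) c) := hcs.map (a ^ i)
    simp only [map_mul] at h1
    generalize (a ^ i) c = c' at h1 hs
    rw [mul_assoc] at h1
    have h3 := cancel hcs h1
    rw [← mul_assoc] at h3
    exact cancel_right hs h3
  obtain ⟨e, he, hec, heo⟩ := lift_all b a π hπ hcomm n hb n le_rfl c hc hco
  have hes : IsSelfAdjoint e := .of_nonneg he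
  let u : ℝ → ℝ := fun t => t / max 1 (t * t)
  have hu : Continuous u := by
    refine continuous_id.div (by fun_prop) fun t => ?_
    have : (1 : ℝ) ≤ max 1 (t * t) := le_max_left _ _
    positivity
  have hu0 : u 0 = 0 := by simp [u]
  let f : ℝ → ℝ := fun t => t * u t
  have hf : Continuous f := continuous_id.mul hu
  have hf0 : f 0 = 0 := by simp [f]
  have hf1 : ∀ t, 0 ≤ f t ∧ f t ≤ 1 := by
    intro t
    have h1 : f t = (t * t) / max 1 (t * t) := by simp only [f, u]; ring
    rw [h1]
    have h2 : (1 : ℝ) ≤ max 1 (t * t) := le_max_left _ _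
    have h3 : 0 ≤ t * t := mul_self_nonneg t
    exact ⟨by positivity, (div_le_one (by positivity)).mpr (le_max_right _ _)⟩
  have hk1 : cfcₙ f e = e * cfcₙ u e := by
    have := cfcₙ_mul (R := ℝ) (fun t => t) u e (by fun_prop) rfl hu.continuousOn hu0
    rw [cfcₙ_id' ℝ e] at this
    exact this
  have hk2 : cfcₙ f e = cfcₙ u e * e := by
    have := cfcₙ_mul (R := ℝ) u (fun t => t) e hu.continuousOn hu0 (by fun_prop) rfl
    rw [cfcₙ_id' ℝ e] at this
    rw [← this]
    congr 1
    funext t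
    exact mul_comm _ _
  refine ⟨cfcₙ f e, cfcₙ_nonneg fun t _ => (hf1 t).1, ?_, ?_, fun _ => ?_⟩
  · rw [NonUnitalStarAlgHomClass.map_cfcₙ π f e hf.continuousOn hf0
      (map_continuous π) hes (hes.map π), hec]
    have h1 : cfcₙ f c = cfcₙ (fun t : ℝ => t * t) c := by
      refine cfcₙ_congr fun t ht => ?_
      have h2 : ‖t‖ ≤ ‖c‖ := NonUnitalIsometricContinuousFunctionalCalculus.norm_quasispectrum_le c ht hcs
      rw [Real.norm_eq_abs] at h2
      have h3 : t * t ≤ 1 := by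
        rw [← abs_mul_abs_self]
        nlinarith [abs_nonneg t]
      simp only [f, u, max_eq_left h3, div_one]
    rw [h1, cfcₙ_mul (R := ℝ) (fun t => t) (fun t => t) c (by fun_prop) rfl (by fun_prop) rfl,
      cfcₙ_id' ℝ c]
  · intro i hi
    have h1 : (b ^ i) (cfcₙ f e) = (b ^ i) e * (b ^ i) (cfcₙ u e) := by rw [hk1, map_mul]
    rw [h1, hk2, mul_assoc, ← mul_assoc e, heo i hi, zero_mul, mul_zero]
  · refine norm_cfcₙ_le fun t _ => ?_
    rw [Real.norm_eq_abs, abs_of_nonneg (hf1 t).1]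
    exact (hf1 t).2

end main

end Stmt3Aux


/-- Let `n ∈ ℕ`, `B` a C*-algebra, `β` a *-automorphism of `B` with
`β^(2^n) = id`. Let `π : B → C` be a surjective *-homomorphism onto a C*-algebra `C`
(the quotient map by the β-invariant closed two-sided ideal `I = ker π`), and let `α`
be the induced *-automorphism of `C`. Let `h : Fin (2^n) → C` be pairwise orthogonal
positive elements which are cyclically shifted by `α` (i.e. `α (h i) = h (i+1)` with
wrap-around addition on `Fin (2^n)`). Then they lift to pairwise orthogonal positive
elements `k : Fin (2^n) → B` which are cyclically shifted by `β`; moreover if all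
`‖h i‖ ≤ 1` then the `k i` can be chosen with `‖k i‖ ≤ 1`. -/
theorem stmt_3 {B C : Type*} [NonUnitalCStarAlgebra B] [NonUnitalCStarAlgebra C]
    (n : ℕ) (β : B ≃⋆ₐ[ℂ] B) (hβ : (⇑β)^[2 ^ n] = id)
    (π : B →⋆ₙₐ[ℂ] C) (hπ : Function.Surjective π)
    (α : C ≃⋆ₐ[ℂ] C) (hcomm : ∀ b : B, α (π b) = π (β b))
    (h : Fin (2 ^ n) → C)
    (hpos : ∀ i, ∃ c : C, h i = star c * c)
    (horth : ∀ i j, i ≠ j → h i * h j = 0)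
    (hshift : ∀ i, α (h i) = h (i + 1)) :
    ∃ k : Fin (2 ^ n) → B,
      (∀ i, ∃ b : B, k i = star b * b) ∧
      (∀ i j, i ≠ j → k i * k j = 0) ∧
      (∀ i, π (k i) = h i) ∧
      (∀ i, β (k i) = k (i + 1)) ∧
      ((∀ i, ‖h i‖ ≤ 1) → ∀ i, ‖k i‖ ≤ 1) := by
  letI : PartialOrder B := CStarAlgebra.spectralOrder B
  haveI : StarOrderedRing B := CStarAlgebra.spectralOrderedRing B
  letI : PartialOrder C := CStarAlgebra.spectralOrder C
  haveI : StarOrderedRing C := CStarAlgebra.spectralOrderedRing C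
  let b : B →⋆ₙₐ[ℂ] B := (β : B →⋆ₙₐ[ℂ] B)
  let a : C →⋆ₙₐ[ℂ] C := (α : C →⋆ₙₐ[ℂ] C)
  have b_apply : ∀ x, b x = β x := fun _ => rfl
  have a_apply : ∀ x, a x = α x := fun _ => rfl
  have b_succ : ∀ (i : ℕ) x, (b ^ (i + 1)) x = β ((b ^ i) x) := by
    intro i x; rw [pow_succ']; rfl
  have a_succ : ∀ (i : ℕ) x, (a ^ (i + 1)) x = α ((a ^ i) x) := by
    intro i x; rw [pow_succ']; rfl
  have b_iter : ∀ (i : ℕ) x, (b ^ i) x = (⇑β)^[i] x := by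
    intro i x
    induction i with
    | zero => simp
    | succ i ih => rw [b_succ, ih, Function.iterate_succ_apply']
  have hb : b ^ (2 ^ n) = 1 := by
    ext x
    rw [b_iter, hβ]; rfl
  have hc : ∀ (i : ℕ) x, π ((b ^ i) x) = (a ^ i) (π x) := by
    intro i x
    induction i with
    | zero => simp
    | succ i ih => rw [b_succ, a_succ, ← ih, hcomm]
  have hah : ∀ i : ℕ, (a ^ i) (h 0) = h (Fin.ofNat (2 ^ n) i) := by
    intro i
    induction i with
    | zero => simp
    | succ i ih =>
      rw [a_succ, ih, hshift]
      congr 1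
      ext
      simp [Fin.val_add, Fin.ofNat]
  have hx : 0 ≤ h 0 := CStarAlgebra.nonneg_iff_eq_star_mul_self.mpr (hpos 0)
  have hxo : ∀ i, ¬ 2 ^ n ∣ i → h 0 * (a ^ i) (h 0) = 0 := by
    intro i hi
    rw [hah]
    refine horth _ _ fun h0 => hi ?_
    have := congrArg Fin.val h0
    simp [Fin.ofNat] at this
    exact Nat.dvd_of_mod_eq_zero this.symm
  obtain ⟨k, hk0, hk1, hk2, hk3⟩ := Stmt3Aux.lift_norm b a π hπ hc n hb (h 0) hx hxo
  refine ⟨fun i => (b ^ (i : ℕ)) k, ?_, ?_, ?_, ?_, ?_⟩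
  · intro i
    exact CStarAlgebra.nonneg_iff_eq_star_mul_self.mp (Stmt3Aux.map_pos _ hk0)
  · intro i j hij
    refine Stmt3Aux.orth_iter b (.of_nonneg hk0) hk2 _ _ fun hmod => hij ?_
    ext
    rw [Nat.ModEq, Nat.mod_eq_of_lt i.2, Nat.mod_eq_of_lt j.2] at hmod
    exact hmod
  · intro i
    simp only [hc, hk1, hah]
    congr 1
    ext
    simp [Fin.ofNat, Nat.mod_eq_of_lt i.2]
  · intro i
    have hper : ∀ j : ℕ, (b ^ (j % 2 ^ n)) k = (b ^ j) k := by
      intro j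
      conv_rhs => rw [← Nat.mod_add_div j (2 ^ n), pow_add, pow_mul, hb, one_pow, mul_one]
    simp only [← b_succ]
    rw [Fin.val_add, hper, pow_add, pow_add]
    have : (b ^ ((1 : Fin (2 ^ n)) : ℕ)) k = (b ^ 1) k := by
      rw [← hper 1]
      congr 2
    change (b ^ (i : ℕ)) ((b ^ 1) k) = (b ^ (i : ℕ)) ((b ^ ((1 : Fin (2 ^ n)) : ℕ)) k)
    rw [this]
  · intro hn i
    exact (NonUnitalStarAlgHom.norm_apply_le (b ^ (i : ℕ)) k).trans (hk3 (hn 0))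
end

section
/- Let X be a locally compact Hausdorff space, let A be a C*-algebra, and let η : C₀(X) → M(A) be a *-homomorphism from the continuous complex functions on X vanishing at infinity into the multiplier algebra of A, whose image is contained in the center of M(A), and such that the set {η(f)·a : f ∈ C₀(X), a ∈ A} is dense in A. For x ∈ X let J_x ⊆ A denote the closed linear span of {η(f)·a : f ∈ C₀(X), f(x) = 0, a ∈ A}. Let B ⊆ A be a C*-subalgebra such that: (1) for every x ∈ X and every a ∈ A there is b ∈ B with a − b ∈ J_x; and (2) η(f)·b ∈ B for all f ∈ C₀(X) and b ∈ B. Then B = A. -/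
open scoped MultiplierAlgebra ZeroAtInfty

section Aux

/-- Convexity estimate for central partitions in a unital C*-algebra. -/
lemma aux_convex {M ι : Type*} [CStarAlgebra M] [PartialOrder M] [StarOrderedRing M]
    (t : Finset ι) (s a : ι → M) (hs : ∀ i, IsSelfAdjoint (s i))
    (hc : ∀ i m, s i * m = m * s i) (hsum : ∑ i ∈ t, s i * s i ≤ 1)
    (r : ℝ) (hr : 0 ≤ r) (ha : ∀ i, ‖a i‖ ≤ r) :
    ‖∑ i ∈ t, s i * s i * a i‖ ≤ r := by
  set T := ∑ i ∈ t, s i * s i * a i with hT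
  have hstarT : star T = ∑ i ∈ t, s i * s i * star (a i) := by
    rw [hT, star_sum]
    refine Finset.sum_congr rfl fun i _ => ?_
    rw [star_mul, star_mul, (hs i).star_eq, ← mul_assoc, ← hc, mul_assoc, ← hc, ← mul_assoc]
  have hterm : ∀ i m n, star (s i * m) * (s i * n) = s i * s i * (star m * n) := by
    intro i m n
    rw [star_mul, (hs i).star_eq, ← hc, mul_assoc, ← mul_assoc (star m), ← hc i (star m)]
    simp only [mul_assoc]
  have h0 : 0 ≤ ∑ i ∈ t, star (s i * (a i - T)) * (s i * (a i - T)) :=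
    Finset.sum_nonneg fun i _ => star_mul_self_nonneg _
  have hexp : ∑ i ∈ t, star (s i * (a i - T)) * (s i * (a i - T))
      = ∑ i ∈ t, s i * s i * (star (a i) * a i) - star T * T - star T * T
        + (∑ i ∈ t, s i * s i) * (star T * T) := by
    have e1 : star T * T = ∑ i ∈ t, s i * s i * (star (a i) * T) := by
      conv_lhs => rw [hstarT, Finset.sum_mul]
      simp only [mul_assoc]
    have e2 : star T * T = ∑ i ∈ t, s i * s i * (star T * a i) := by
      conv_lhs => rw [hT, Finset.mul_sum, ← hT]
      refine Finset.sum_congr rfl fun i _ => ?_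
      rw [← mul_assoc, ← mul_assoc, ← hc, mul_assoc (s i), ← hc]
      simp only [mul_assoc]
    conv_rhs => enter [1, 2]; rw [e2]
    conv_rhs => enter [1, 1, 2]; rw [e1]
    rw [Finset.sum_mul, ← Finset.sum_sub_distrib, ← Finset.sum_sub_distrib,
      ← Finset.sum_add_distrib]
    refine Finset.sum_congr rfl fun i _ => ?_
    rw [hterm, star_sub]
    noncomm_ring
  have h3 : (∑ i ∈ t, s i * s i) * (star T * T) ≤ star T * T := by
    have := star_left_conjugate_le_conjugate hsum T
    rw [mul_one] at this
    have hcs : star T * (∑ i ∈ t, s i * s i) = (∑ i ∈ t, s i * s i) * star T := by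
      rw [Finset.sum_mul, Finset.mul_sum]
      refine Finset.sum_congr rfl fun i _ => ?_
      rw [← mul_assoc, ← hc, mul_assoc, ← hc]
    rwa [hcs, mul_assoc] at this
  have h4 : ∑ i ∈ t, s i * s i * (star (a i) * a i) ≤ algebraMap ℝ M (r ^ 2) := by
    have hi : ∀ i ∈ t, s i * s i * (star (a i) * a i) ≤ (r ^ 2) • (s i * s i) := by
      intro i _
      have h5 : star (a i) * a i ≤ algebraMap ℝ M (r ^ 2) := by
        refine (CStarAlgebra.star_mul_le_algebraMap_norm_sq).trans ?_
        exact algebraMap_mono _ (by have := ha i; gcongr)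
      have := star_left_conjugate_le_conjugate h5 (s i)
      rw [(hs i).star_eq, Algebra.algebraMap_eq_smul_one] at this
      rw [mul_assoc, hc i (star (a i) * a i), ← mul_assoc]
      simpa using this
    refine (Finset.sum_le_sum hi).trans ?_
    rw [← Finset.smul_sum, Algebra.algebraMap_eq_smul_one]
    exact smul_le_smul_of_nonneg_left hsum (by positivity)
  have h6 : star T * T ≤ algebraMap ℝ M (r ^ 2) := by
    rw [hexp] at h0
    have : star T * T ≤ ∑ i ∈ t, s i * s i * (star (a i) * a i) := by
      have h8 : ∑ i ∈ t, s i * s i * (star (a i) * a i) - star T * T - star T * T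
        + (∑ i ∈ t, s i * s i) * (star T * T) ≤
          ∑ i ∈ t, s i * s i * (star (a i) * a i) - star T * T - star T * T + star T * T := by
        gcongr
      have h9 := h0.trans h8
      rw [sub_add_cancel] at h9
      exact sub_nonneg.1 h9
    exact this.trans h4
  have h7 : ‖star T * T‖ ≤ r ^ 2 :=
    (CStarAlgebra.norm_le_iff_le_algebraMap _ (by positivity) (star_mul_self_nonneg T)).2 h6
  rw [CStarRing.norm_star_mul_self, ← sq] at h7
  exact (sq_le_sq₀ (norm_nonneg _) hr).1 h7

lemma aux_toC0 {X : Type*} [TopologicalSpace X] (f : C(X, ℝ)) (hf : HasCompactSupport f) :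
    ∃ F : C₀(X, ℂ), ∀ x, F x = (f x : ℂ) := by
  refine ⟨⟨⟨fun x => (f x : ℂ), by fun_prop⟩, ?_⟩, fun x => rfl⟩
  have : HasCompactSupport (fun x => (f x : ℂ)) := hf.comp_left (g := Complex.ofReal) (by simp)
  exact this.is_zero_at_infty

lemma aux_norm_le {X : Type*} [TopologicalSpace X] (f : C₀(X, ℂ)) (r : ℝ) (hr : 0 ≤ r)
    (h : ∀ x, ‖f x‖ ≤ r) : ‖f‖ ≤ r := by
  rw [← ZeroAtInftyContinuousMap.norm_toBCF_eq_norm]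
  exact (BoundedContinuousFunction.norm_le hr).2 h

lemma aux_bump {X : Type*} [TopologicalSpace X] [T2Space X] [LocallyCompactSpace X]
    (x : X) (U : Set X) (hU : IsOpen U) (hx : x ∈ U) :
    ∃ k : C₀(X, ℂ), ‖k‖ ≤ 1 ∧ (∀ᶠ y in nhds x, k y = 1) ∧ (∀ y, ‖k y‖ ≤ 1) ∧
      ∀ y, y ∉ U → k y = 0 := by
  obtain ⟨K, hK, hxK, hKU⟩ := exists_compact_subset hU hx
  obtain ⟨f, hf1, hf0, hfc, hf⟩ := exists_continuous_one_zero_of_isCompact hK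
    hU.isClosed_compl (Set.disjoint_compl_right_iff_subset.2 hKU)
  obtain ⟨F, hF⟩ := aux_toC0 f hfc
  have hn : ∀ y, ‖F y‖ ≤ 1 := by
    intro y
    rw [hF, Complex.norm_real, Real.norm_eq_abs, abs_of_nonneg (hf y).1]
    exact (hf y).2
  refine ⟨F, aux_norm_le _ _ zero_le_one hn, ?_, hn, ?_⟩
  · filter_upwards [mem_interior_iff_mem_nhds.1 hxK] with y hy
    simp [hF, hf1 hy]
  · intro y hy
    simp [hF, hf0 hy]

lemma aux_local {X M : Type*} [TopologicalSpace X] [T2Space X] [LocallyCompactSpace X]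
    [CStarAlgebra M] (η : C₀(X, ℂ) →⋆ₙₐ[ℂ] M) (x : X) (e : M)
    (he : e ∈ closure (Submodule.span ℂ
      {y : M | ∃ (f : C₀(X, ℂ)) (a' : M), f x = 0 ∧ y = η f * a'} : Set M))
    (ε : ℝ) (hε : 0 < ε) :
    ∃ k : C₀(X, ℂ), ‖k‖ ≤ 1 ∧ (∀ᶠ y in nhds x, k y = 1) ∧ ‖η k * e‖ < ε := by
  have hη : ∀ f, ‖η f‖ ≤ ‖f‖ := fun f => NonUnitalStarAlgHom.norm_apply_le η f
  have key : ∀ e ∈ Submodule.span ℂ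
      {y : M | ∃ (f : C₀(X, ℂ)) (a' : M), f x = 0 ∧ y = η f * a'}, ∀ ε > 0,
      ∃ k : C₀(X, ℂ), ‖k‖ ≤ 1 ∧ (∀ᶠ y in nhds x, k y = 1) ∧ ‖η k * e‖ < ε := by
    intro e he
    induction he using Submodule.span_induction with
    | mem e he =>
      obtain ⟨f, a, hfx, rfl⟩ := he
      intro ε hε
      set δ := ε / (2 * (‖a‖ + 1)) with hδ
      have hδ0 : 0 < δ := by positivity
      obtain ⟨k, hk1, hk2, hk3, hk4⟩ := aux_bump x {y | ‖f y‖ < δ}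
        (isOpen_lt (by fun_prop) continuous_const) (by simpa [hfx] using hδ0)
      refine ⟨k, hk1, hk2, ?_⟩
      have hkf : ‖k * f‖ ≤ δ := by
        refine aux_norm_le _ _ hδ0.le fun y => ?_
        rw [ZeroAtInftyContinuousMap.mul_apply, norm_mul]
        by_cases hy : ‖f y‖ < δ
        · calc _ ≤ 1 * δ := by have := hk3 y; gcongr
            _ = δ := one_mul _
        · rw [hk4 y hy]; simpa using hδ0.le
      rw [← mul_assoc, ← map_mul]
      calc _ ≤ ‖η (k * f)‖ * ‖a‖ := norm_mul_le _ _
        _ ≤ δ * (‖a‖ + 1) := by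
          have := (hη (k * f)).trans hkf
          gcongr
          linarith
        _ = ε / 2 := by rw [hδ]; field_simp
        _ < ε := by linarith
    | zero =>
      intro ε hε
      obtain ⟨k, hk1, hk2, -⟩ := aux_bump x Set.univ isOpen_univ trivial
      exact ⟨k, hk1, hk2, by simpa using hε⟩
    | add e₁ e₂ _ _ h₁ h₂ =>
      intro ε hε
      obtain ⟨k₁, a1, b1, c1⟩ := h₁ (ε / 2) (by positivity)
      obtain ⟨k₂, a2, b2, c2⟩ := h₂ (ε / 2) (by positivity)
      refine ⟨k₁ * k₂, ?_, ?_, ?_⟩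
      · exact (norm_mul_le _ _).trans (mul_le_one₀ a1 (norm_nonneg _) a2)
      · filter_upwards [b1, b2] with y h1 h2
        simp [h1, h2]
      · have e1 : ‖η (k₁ * k₂) * e₁‖ < ε / 2 := by
          rw [mul_comm k₁, map_mul, mul_assoc]
          refine ((norm_mul_le _ _).trans ?_).trans_lt c1
          exact mul_le_of_le_one_left (norm_nonneg _) ((hη _).trans a2)
        have e2 : ‖η (k₁ * k₂) * e₂‖ < ε / 2 := by
          rw [map_mul, mul_assoc]
          refine ((norm_mul_le _ _).trans ?_).trans_lt c2
          exact mul_le_of_le_one_left (norm_nonneg _) ((hη _).trans a1)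
        rw [mul_add]
        have := norm_add_le (η (k₁ * k₂) * e₁) (η (k₁ * k₂) * e₂)
        linarith
    | smul c e _ h =>
      intro ε hε
      obtain ⟨k, a1, b1, c1⟩ := h (ε / (‖c‖ + 1)) (by positivity)
      refine ⟨k, a1, b1, ?_⟩
      rw [mul_smul_comm, norm_smul]
      rw [lt_div_iff₀ (by positivity)] at c1
      have := norm_nonneg (η k * e)
      nlinarith
  obtain ⟨e', he', hd⟩ := Metric.mem_closure_iff.1 he (ε / 2) (by positivity)
  obtain ⟨k, a1, b1, c1⟩ := key e' he' (ε / 2) (by positivity)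
  refine ⟨k, a1, b1, ?_⟩
  have : η k * e = η k * (e - e') + η k * e' := by rw [← mul_add, sub_add_cancel]
  rw [this]
  have h1 : ‖η k * (e - e')‖ ≤ ‖e - e'‖ := (norm_mul_le _ _).trans
    (mul_le_of_le_one_left (norm_nonneg _) ((hη _).trans a1))
  rw [dist_eq_norm] at hd
  have := norm_add_le (η k * (e - e')) (η k * e')
  linarith

lemma aux_main {X M : Type*} [TopologicalSpace X] [T2Space X] [LocallyCompactSpace X]
    [CStarAlgebra M] (η : C₀(X, ℂ) →⋆ₙₐ[ℂ] M) (hc : ∀ f m, η f * m = m * η f)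
    (B : Submodule ℂ M) (hB : ∀ f, ∀ b ∈ B, η f * b ∈ B) (c : M)
    (h1 : ∀ x : X, ∃ b ∈ B, c - b ∈ closure (Submodule.span ℂ
      {y : M | ∃ (f : C₀(X, ℂ)) (a' : M), f x = 0 ∧ y = η f * a'} : Set M))
    (g : C₀(X, ℂ)) : η g * c ∈ closure (B : Set M) := by
  let _ : PartialOrder M := CStarAlgebra.spectralOrder M
  have : StarOrderedRing M := CStarAlgebra.spectralOrderedRing M
  have hη : ∀ f, ‖η f‖ ≤ ‖f‖ := fun f => NonUnitalStarAlgHom.norm_apply_le η f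
  rw [Metric.mem_closure_iff]
  intro ε hε
  set δ := ε / (2 * (‖c‖ + ‖g‖ + 1)) with hδ
  have hδ0 : 0 < δ := by positivity
  have hloc : ∀ x : X, ∃ b ∈ B, ∃ k : C₀(X, ℂ), ∃ U : Set X, IsOpen U ∧ x ∈ U ∧
      (∀ y ∈ U, k y = 1) ∧ ‖η k * (c - b)‖ ≤ δ := by
    intro x
    obtain ⟨b, hb, hbc⟩ := h1 x
    obtain ⟨k, -, hk, hk'⟩ := aux_local η x _ hbc δ hδ0
    obtain ⟨U, hU, hUo, hxU⟩ := eventually_nhds_iff.1 hk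
    exact ⟨b, hb, k, U, hUo, hxU, hU, hk'.le⟩
  choose b hb k U hUo hxU hkU hkb using hloc
  obtain ⟨K, hK, hKg⟩ : ∃ K : Set X, IsCompact K ∧ ∀ y ∉ K, ‖g y‖ ≤ δ := by
    have := (zero_at_infty g).eventually (Metric.ball_mem_nhds 0 hδ0)
    obtain ⟨K, hK, hKs⟩ := Filter.mem_cocompact.1 this
    exact ⟨K, hK, fun y hy => by
      have h := hKs hy
      rw [Set.mem_ofPred_eq, dist_zero_right] at h
      exact h.le⟩
  obtain ⟨t, ht⟩ := hK.elim_finite_subcover U hUo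
    (fun x _ => Set.mem_iUnion.2 ⟨x, hxU x⟩)
  obtain ⟨p, hp, hpc⟩ := PartitionOfUnity.exists_isSubordinate_of_locallyFinite_t2space hK
    (fun i : t => U i) (fun i => hUo i) (locallyFinite_of_finite _)
    (by simpa [Set.iUnion_subtype] using ht)
  have hsq : ∀ i : t, ∃ F : C₀(X, ℂ), ∀ x, F x = (Real.sqrt (p i x) : ℂ) := fun i =>
    aux_toC0 ⟨fun x => Real.sqrt (p i x), by fun_prop⟩
      ((hpc i).comp_left (g := Real.sqrt) (by simp))
  choose s hs using hsq
  have hss : ∀ i x, (s i * s i) x = (p i x : ℂ) := by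
    intro i x
    rw [ZeroAtInftyContinuousMap.mul_apply, hs, ← Complex.ofReal_mul,
      Real.mul_self_sqrt (p.nonneg i x)]
  have hsumx : ∀ x, (∑ i, s i * s i) x = ((∑ i, p i x : ℝ) : ℂ) := by
    intro x
    have : (∑ i, s i * s i) x = ∑ i, (s i * s i) x := by
      classical
      induction (Finset.univ : Finset t) using Finset.induction_on with
      | empty => simp
      | insert a u ha ih => rw [Finset.sum_insert ha, Finset.sum_insert ha, ← ih]; rfl
    rw [this, Complex.ofReal_sum]
    exact Finset.sum_congr rfl fun i _ => hss i x
  have hle : ∀ x, ∑ i, p i x ≤ 1 := fun x => by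
    rw [← finsum_eq_sum_of_fintype]; exact p.sum_le_one x
  have hge : ∀ x, 0 ≤ ∑ i, p i x := fun x => Finset.sum_nonneg fun i _ => p.nonneg i x
  have hone : ∀ x ∈ K, ∑ i, p i x = 1 := fun x hx => by
    rw [← finsum_eq_sum_of_fintype]; exact p.sum_eq_one hx
  have hsa : ∀ i, IsSelfAdjoint (s i) := by
    intro i
    ext x
    rw [ZeroAtInftyContinuousMap.star_apply, hs]
    simp
  have hsa' : ∀ i, IsSelfAdjoint (η (s i)) := fun i => (hsa i).map η
  have hsum1 : ∑ i, η (s i) * η (s i) ≤ 1 := by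
    have hn : 0 ≤ ∑ i, η (s i) * η (s i) := Finset.sum_nonneg fun i _ => (hsa' i).mul_self_nonneg
    rw [← CStarAlgebra.norm_le_one_iff_of_nonneg _ hn]
    have : ∑ i, η (s i) * η (s i) = η (∑ i, s i * s i) := by simp [map_sum]
    rw [this]
    refine (hη _).trans (aux_norm_le _ _ zero_le_one fun x => ?_)
    rw [hsumx, Complex.norm_real, Real.norm_eq_abs, abs_of_nonneg (hge x)]
    exact hle x
  have hsk : ∀ i : t, s i * k i = s i := by
    intro i
    ext x
    rw [ZeroAtInftyContinuousMap.mul_apply]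
    by_cases hx : x ∈ U i
    · rw [hkU i x hx, mul_one]
    · have : p i x = 0 := by
        by_contra hne
        exact hx (hp i (subset_tsupport _ hne))
      simp [hs, this]
  have hconv := aux_convex Finset.univ (fun i => η (s i)) (fun i : t => η (k i) * (c - b i))
    hsa' (fun i m => hc _ m) hsum1 δ hδ0.le (fun i => hkb i)
  set u := ∑ i : t, η (s i) * (η (s i) * b i) with hu
  refine ⟨η g * u, hB _ _ (B.sum_mem fun i _ => hB _ _ (hB _ _ (hb i))), ?_⟩
  have hdec : η g * c - η g * u = η (g - g * ∑ i, s i * s i) * c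
      + η g * ∑ i, η (s i) * η (s i) * (η (k i) * (c - b i)) := by
    have e1 : ∀ i : t, η (s i) * η (s i) * (η (k i) * (c - b i))
        = η (s i * s i) * c - η (s i) * (η (s i) * b i) := by
      intro i
      rw [← mul_assoc, mul_assoc (η (s i)), ← map_mul, ← map_mul, hsk, mul_sub,
        ← mul_assoc (η (s i)) (η (s i)), ← map_mul]
    rw [Finset.sum_congr rfl fun i _ => e1 i, Finset.sum_sub_distrib, ← hu, ← Finset.sum_mul,
      ← map_sum, map_sub, map_mul]
    noncomm_ring
  rw [dist_eq_norm, hdec]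
  have n1 : ‖η (g - g * ∑ i, s i * s i)‖ ≤ δ := by
    refine (hη _).trans (aux_norm_le _ _ hδ0.le fun x => ?_)
    rw [ZeroAtInftyContinuousMap.sub_apply, ZeroAtInftyContinuousMap.mul_apply, hsumx]
    by_cases hx : x ∈ K
    · rw [hone x hx]; simpa using hδ0.le
    · have : g x - g x * ((∑ i, p i x : ℝ) : ℂ) = g x * ((1 - ∑ i, p i x : ℝ) : ℂ) := by
        push_cast; ring
      rw [this, norm_mul, Complex.norm_real, Real.norm_eq_abs,
        abs_of_nonneg (by linarith [hle x])]
      exact (mul_le_of_le_one_right (norm_nonneg _) (by linarith [hge x])).trans (hKg x hx)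
  calc _ ≤ ‖η (g - g * ∑ i, s i * s i)‖ * ‖c‖
        + ‖η g‖ * ‖∑ i, η (s i) * η (s i) * (η (k i) * (c - b i))‖ :=
        (norm_add_le _ _).trans (add_le_add (norm_mul_le _ _) (norm_mul_le _ _))
    _ ≤ δ * ‖c‖ + ‖g‖ * δ := by
      have := hη g
      gcongr
    _ ≤ δ * (‖c‖ + ‖g‖ + 1) := by nlinarith
    _ = ε / 2 := by rw [hδ]; field_simp
    _ < ε := by linarith

lemma aux_coe_isometry {A : Type*} [NonUnitalCStarAlgebra A] (a : A) :
    ‖DoubleCentralizer.coeHom (𝕜 := ℂ) a‖ = ‖a‖ := by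
  rw [← DoubleCentralizer.norm_fst]
  exact ContinuousLinearMap.opNorm_mul_apply ℂ A a

lemma aux_coe_mul {A : Type*} [NonUnitalCStarAlgebra A] (m : 𝓜(ℂ, A)) (a : A) :
    m * DoubleCentralizer.coeHom (𝕜 := ℂ) a = DoubleCentralizer.coeHom (𝕜 := ℂ) (m.fst a) := by
  have hfst : ∀ x y : A, m.fst (x * y) = m.fst x * y := by
    intro x y
    rw [← sub_eq_zero]
    have : ∀ z : A, z * (m.fst (x * y) - m.fst x * y) = 0 := by
      intro z
      rw [mul_sub, ← m.central, ← mul_assoc, ← mul_assoc, ← m.central, sub_self]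
    exact CStarRing.star_mul_self_eq_zero_iff _ |>.1 (this _)
  ext x
  · simp [hfst]
  · simp [m.central]

end Aux

/-- Let `X` be a locally compact Hausdorff space, `A` a C*-algebra, and
`η : C₀(X) → M(A)` a *-homomorphism into the multiplier algebra of `A` whose image lies in
the center of `M(A)` and such that `{η(f)·a}` is dense in `A` (here `m·a = m.fst a` is the
action of a multiplier on `A`). For `x ∈ X` let `J_x` be the closed linear span of
`{η(f)·a : f x = 0}`. If `B ⊆ A` is a C*-subalgebra such that (1) for every `x` and `a`
there is `b ∈ B` with `a - b ∈ J_x`, and (2) `η(f)·b ∈ B` for all `f` and `b ∈ B`,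
then `B = A`. -/
theorem stmt_4 {X A : Type*} [TopologicalSpace X] [T2Space X] [LocallyCompactSpace X]
    [NonUnitalCStarAlgebra A]
    (η : C₀(X, ℂ) →⋆ₙₐ[ℂ] 𝓜(ℂ, A))
    (hcentral : ∀ f : C₀(X, ℂ), η f ∈ Set.center (𝓜(ℂ, A)))
    (hdense : Dense {y : A | ∃ (f : C₀(X, ℂ)) (a : A), y = (η f).fst a})
    (B : NonUnitalStarSubalgebra ℂ A) (hB : IsClosed (B : Set A))
    (h1 : ∀ (x : X) (a : A), ∃ b ∈ B, a - b ∈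
        closure (Submodule.span ℂ
          {y : A | ∃ (f : C₀(X, ℂ)) (a' : A), f x = 0 ∧ y = (η f).fst a'} : Set A))
    (h2 : ∀ (f : C₀(X, ℂ)) (b : A), b ∈ B → (η f).fst b ∈ B) :
    B = ⊤ := by
  have hcoe : Isometry (DoubleCentralizer.coeHom (𝕜 := ℂ) (A := A)) :=
    AddMonoidHomClass.isometry_of_norm _ aux_coe_isometry
  set φ := DoubleCentralizer.coeHom (𝕜 := ℂ) (A := A) with hφ
  let L : A →ₗ[ℂ] 𝓜(ℂ, A) := (φ : A →ₗ[ℂ] 𝓜(ℂ, A))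
  have hmem : ∀ (g : C₀(X, ℂ)) (c : A), (η g).fst c ∈ B := by
    intro g c
    have := aux_main η (fun f m => ((hcentral f).comm m)) (B.toSubmodule.map L)
      (by
        rintro f _ ⟨b, hb, rfl⟩
        exact ⟨(η f).fst b, h2 f b hb, (aux_coe_mul _ _).symm⟩) (φ c)
      (by
        intro x
        obtain ⟨b, hb, hbc⟩ := h1 x c
        refine ⟨φ b, ⟨b, hb, rfl⟩, ?_⟩
        rw [← map_sub]
        refine map_mem_closure hcoe.continuous hbc ?_
        intro y hy
        have hy' : L y ∈ (Submodule.span ℂ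
          {y : A | ∃ (f : C₀(X, ℂ)) (a' : A), f x = 0 ∧ y = (η f).fst a'}).map L :=
          ⟨y, hy, rfl⟩
        rw [Submodule.map_span] at hy'
        refine Submodule.span_mono ?_ hy'
        rintro _ ⟨_, ⟨f, a, hf, rfl⟩, rfl⟩
        exact ⟨f, φ a, hf, (aux_coe_mul _ _).symm⟩) g
    rw [aux_coe_mul] at this
    have h3 : IsClosed (φ '' (B : Set A)) := hcoe.isClosedEmbedding.isClosedMap _ hB
    have h4 : ((B.toSubmodule.map L : Submodule ℂ _) : Set 𝓜(ℂ, A)) = φ '' (B : Set A) := rfl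
    rw [h4, h3.closure_eq] at this
    obtain ⟨b, hb, hbe⟩ := this
    rwa [← hcoe.injective hbe]
  rw [eq_top_iff]
  intro a _
  have hsub : {y : A | ∃ (f : C₀(X, ℂ)) (a : A), y = (η f).fst a} ⊆ (B : Set A) := by
    rintro _ ⟨f, a, rfl⟩
    exact hmem f a
  exact hB.closure_subset_iff.2 hsub (hdense a)
end

section
/- Let X be a uniform space which is uniformly finitistic, and let π : A → B be a surjective *-homomorphism between C*-algebras. Then every bounded uniformly continuous function g : X → B lifts to a bounded uniformly continuous function f : X → A with π(f(x)) = g(x) for all x ∈ X; that is, the induced map from the bounded uniformly continuous A-valued functions on X to the bounded uniformly continuous B-valued functions on X is surjective. -/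
open scoped Uniformity

/-- A cover `𝒰` of a uniform space `X` is *uniform* if there is an entourage `V` such that
every `V`-ball is contained in some member of `𝒰`. -/
def IsUniformCover {X : Type*} [UniformSpace X] (𝒰 : Set (Set X)) : Prop :=
  ∃ V ∈ 𝓤 X, ∀ x : X, ∃ U ∈ 𝒰, UniformSpace.ball x V ⊆ U

/-- A uniform space is *uniformly finitistic* if every uniform open cover is refined by a
uniform open cover of finite order (any `n+1` distinct members intersect trivially). -/
def UniformlyFinitistic (X : Type*) [UniformSpace X] : Prop :=
  ∀ 𝒰 : Set (Set X), (∀ U ∈ 𝒰, IsOpen U) → IsUniformCover 𝒰 →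
    ∃ 𝒱 : Set (Set X), (∀ V ∈ 𝒱, IsOpen V) ∧ IsUniformCover 𝒱 ∧
      (∀ V ∈ 𝒱, ∃ U ∈ 𝒰, V ⊆ U) ∧
      ∃ n : ℕ, ∀ S : Finset (Set X), (S : Set (Set X)) ⊆ 𝒱 → n < S.card →
        ⋂₀ (S : Set (Set X)) = ∅

open Filter Topology in
/-- Every entourage contains a ball relation of a uniformly continuous pseudometric. -/
theorem aux_pseudoMetric {X : Type*} [u : UniformSpace X] {V : Set (X × X)} (hV : V ∈ 𝓤 X) :
    ∃ d : PseudoMetricSpace X, u ≤ d.toUniformSpace ∧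
      ∃ δ > 0, ∀ x y, d.dist x y < δ → (x, y) ∈ V := by
  have key : ∀ W : {W : Set (X × X) // W ∈ 𝓤 X}, ∃ W' : {W : Set (X × X) // W ∈ 𝓤 X},
      (∀ x y, (x, y) ∈ W'.1 → (y, x) ∈ W'.1) ∧
      (∀ x y z, (x, y) ∈ W'.1 → (y, z) ∈ W'.1 → (x, z) ∈ W.1) := by
    rintro ⟨W, hW⟩
    obtain ⟨t, ht, hs, hc⟩ := comp_symm_mem_uniformity_sets hW
    refine ⟨⟨t, ht⟩, fun x y h => hs.symm _ _ h, fun x y z h1 h2 => hc ?_⟩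
    exact ⟨y, h1, h2⟩
  choose nxt hsym hcomp using key
  let s : ℕ → {W : Set (X × X) // W ∈ 𝓤 X} := fun k => Nat.rec (nxt ⟨V, hV⟩) (fun _ W => nxt W) k
  have hs_succ : ∀ k, s (k+1) = nxt (s k) := fun k => rfl
  have hs_symm : ∀ k x y, (x, y) ∈ (s k).1 → (y, x) ∈ (s k).1 := by
    intro k
    cases k with
    | zero => exact hsym _
    | succ k => exact hsym _
  have hs_comp : ∀ k x y z, (x, y) ∈ (s (k+1)).1 → (y, z) ∈ (s (k+1)).1 → (x, z) ∈ (s k).1 :=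
    fun k => hcomp _
  have hs_refl : ∀ k x, (x, x) ∈ (s k).1 := fun k x => refl_mem_uniformity (s k).2
  have hanti : Antitone (fun k => (s k).1) := by
    refine antitone_nat_of_succ_le fun k => ?_
    rintro ⟨x, y⟩ h
    exact hs_comp k x y y h (hs_refl (k+1) y)
  have hbasis : (⨅ k, 𝓟 (s k).1).HasBasis (fun _ : ℕ => True) (fun k => (s k).1) :=
    hasBasis_iInf_principal hanti.directed_ge
  let c : UniformSpace.Core X := UniformSpace.Core.mk' (⨅ k, 𝓟 (s k).1)
    (by
      intro r hr x
      obtain ⟨k, -, hk⟩ := hbasis.mem_iff.1 hr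
      exact hk (hs_refl k x))
    (by
      intro r hr
      obtain ⟨k, -, hk⟩ := hbasis.mem_iff.1 hr
      refine hbasis.mem_iff.2 ⟨k, trivial, ?_⟩
      rintro ⟨x, y⟩ h
      exact hk (hs_symm k x y h))
    (by
      intro r hr
      obtain ⟨k, -, hk⟩ := hbasis.mem_iff.1 hr
      refine ⟨(s (k+1)).1, hbasis.mem_of_mem (i := k+1) trivial, ?_⟩
      rintro ⟨x, z⟩ ⟨y, h1, h2⟩
      exact hk (hs_comp k x y z h1 h2))
  let u' : UniformSpace X := UniformSpace.ofCore c
  have hu' : 𝓤[u'] = ⨅ k, 𝓟 (s k).1 := rfl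
  have : IsCountablyGenerated (𝓤[u']) := by rw [hu']; infer_instance
  let d := @UniformSpace.pseudoMetricSpace X u' this
  have hd : d.toUniformSpace = u' := rfl
  refine ⟨d, ?_, ?_⟩
  · rw [hd]
    change 𝓤[u] ≤ 𝓤[u']
    rw [hu']
    refine le_iInf fun k => ?_
    rw [le_principal_iff]
    exact (s k).2
  · have hV' : V ∈ 𝓤[d.toUniformSpace] := by
      rw [hd, hu']
      refine hbasis.mem_iff.2 ⟨0, trivial, ?_⟩
      rintro ⟨x, y⟩ h
      exact hcomp ⟨V, hV⟩ x y y h (hs_refl 0 y)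
    obtain ⟨δ, hδ, h⟩ := (@Metric.mem_uniformity_dist X d V).1 hV'
    exact ⟨δ, hδ, fun x y hxy => h hxy⟩

/-- Lipschitz partition of unity subordinate to a uniform cover of finite order. -/
theorem aux_partition {X : Type*} [PseudoMetricSpace X] (𝒱 : Set (Set X)) (n : ℕ)
    (hn : ∀ S : Finset (Set X), (S : Set (Set X)) ⊆ 𝒱 → n < S.card →
        ⋂₀ (S : Set (Set X)) = ∅)
    (δ : ℝ) (hδ : 0 < δ) (hL : ∀ x, ∃ U ∈ 𝒱, ∀ y, dist x y < δ → y ∈ U) :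
    ∃ (φ : Set X → X → ℝ) (T : X → Finset (Set X)) (L : ℝ), 0 ≤ L ∧
      (∀ U x, 0 ≤ φ U x) ∧ (∀ x U, U ∈ T x ↔ U ∈ 𝒱 ∧ x ∈ U) ∧
      (∀ x U, U ∉ T x → φ U x = 0) ∧ (∀ x, ∑ U ∈ T x, φ U x = 1) ∧
      (∀ U x y, |φ U x - φ U y| ≤ L * dist x y) ∧ (∀ x, (T x).card ≤ n) := by
  classical
  have hcard : ∀ x (S : Finset (Set X)), (∀ U ∈ S, U ∈ 𝒱 ∧ x ∈ U) → S.card ≤ n := by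
    intro x S hS
    by_contra h
    have := hn S (fun U hU => (hS U hU).1) (not_le.1 h)
    have hx : x ∈ ⋂₀ (S : Set (Set X)) := fun U hU => (hS U hU).2
    rw [this] at hx
    exact hx
  have hfin : ∀ x, {U | U ∈ 𝒱 ∧ x ∈ U}.Finite := by
    intro x
    by_contra h
    obtain ⟨S, hS, hc⟩ := Set.Infinite.exists_subset_card_eq h (n+1)
    have := hcard x S (fun U hU => hS hU)
    omega
  let T : X → Finset (Set X) := fun x => (hfin x).toFinset
  have hT : ∀ x U, U ∈ T x ↔ U ∈ 𝒱 ∧ x ∈ U := fun x U => by simp [T]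
  have hTc : ∀ x, (T x).card ≤ n := fun x => hcard x _ (fun U hU => (hT x U).1 hU)
  let ψ : Set X → X → ℝ := fun U x =>
    if U ∈ 𝒱 then (if U = Set.univ then δ else Metric.infDist x Uᶜ) else 0
  have hψ0 : ∀ U x, 0 ≤ ψ U x := by
    intro U x
    simp only [ψ]
    split_ifs
    · exact hδ.le
    · exact Metric.infDist_nonneg
    · exact le_rfl
  have hψT : ∀ x U, U ∉ T x → ψ U x = 0 := by
    intro x U h
    rw [hT] at h
    simp only [ψ]
    split_ifs with h1 h2
    · exact absurd ⟨h1, by rw [h2]; trivial⟩ h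
    · exact Metric.infDist_zero_of_mem (fun hx => h ⟨h1, hx⟩)
    · rfl
  have hψL : ∀ U x y, |ψ U x - ψ U y| ≤ dist x y := by
    intro U x y
    simp only [ψ]
    split_ifs with h1 h2
    · simp
    · have := (Metric.lipschitz_infDist_pt Uᶜ).dist_le_mul x y
      simpa [Real.dist_eq] using this
    · simp
  let S : X → ℝ := fun x => ∑ U ∈ T x, ψ U x
  have hSle : ∀ U x, ψ U x ≤ S x := by
    intro U x
    by_cases h : U ∈ T x
    · exact Finset.single_le_sum (f := fun U => ψ U x) (fun U _ => hψ0 U x) h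
    · rw [hψT x U h]
      exact Finset.sum_nonneg (fun U _ => hψ0 U x)
  have hSδ : ∀ x, δ ≤ S x := by
    intro x
    obtain ⟨U, hU, h⟩ := hL x
    refine le_trans ?_ (hSle U x)
    simp only [ψ, if_pos hU]
    split_ifs with h2
    · exact le_rfl
    · refine (Metric.le_infDist (Set.nonempty_compl.2 h2)).2 fun y hy => ?_
      by_contra hc
      exact hy (h y (not_le.1 hc))
  have hSpos : ∀ x, 0 < S x := fun x => hδ.trans_le (hSδ x)
  have hSU : ∀ x (R : Finset (Set X)), T x ⊆ R → S x = ∑ U ∈ R, ψ U x := fun x R h =>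
    Finset.sum_subset h (fun U _ hU => hψT x U hU)
  have hSL : ∀ x y, |S x - S y| ≤ 2 * n * dist x y := by
    intro x y
    rw [hSU x (T x ∪ T y) Finset.subset_union_left, hSU y (T x ∪ T y) Finset.subset_union_right,
      ← Finset.sum_sub_distrib]
    refine (Finset.abs_sum_le_sum_abs _ _).trans ?_
    refine (Finset.sum_le_card_nsmul _ _ _ (fun U _ => hψL U x y)).trans ?_
    rw [nsmul_eq_mul]
    refine mul_le_mul_of_nonneg_right ?_ dist_nonneg
    have : (T x ∪ T y).card ≤ 2 * n := (Finset.card_union_le _ _).trans (by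
      have := hTc x
      have := hTc y
      omega)
    exact_mod_cast this
  refine ⟨fun U x => ψ U x / S x, T, (1 + 2 * n) / δ, by positivity,
    fun U x => div_nonneg (hψ0 U x) (hSpos x).le, hT, fun x U h => by simp [hψT x U h], ?_, ?_, hTc⟩
  · intro x
    rw [← Finset.sum_div]
    exact div_self (hSpos x).ne'
  · intro U x y
    have e : ψ U x / S x - ψ U y / S y
        = ((ψ U x - ψ U y) + (ψ U y / S y) * (S y - S x)) / S x := by
      have h1 := (hSpos x).ne'
      have h2 := (hSpos y).ne'
      field_simp
      ring
    have hr : ψ U y / S y ≤ 1 := (div_le_one (hSpos y)).2 (hSle U y)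
    have hr0 : 0 ≤ ψ U y / S y := div_nonneg (hψ0 U y) (hSpos y).le
    rw [e, abs_div, abs_of_pos (hSpos x), div_mul_eq_mul_div (1 + 2 * (n : ℝ))]
    have hnum : |(ψ U x - ψ U y) + (ψ U y / S y) * (S y - S x)| ≤ (1 + 2 * n) * dist x y := by
      refine (abs_add_le _ _).trans ?_
      rw [abs_mul, abs_of_nonneg hr0]
      have h1 := hψL U x y
      have h2 := hSL y x
      rw [dist_comm y x] at h2
      have h3 := mul_le_mul hr h2 (abs_nonneg _) zero_le_one
      linarith
    exact div_le_div₀ (by positivity) hnum hδ (hSδ x)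

/-- One approximation step. -/
theorem aux_step {X E F : Type*} [u : UniformSpace X]
    [NormedAddCommGroup E] [NormedSpace ℝ E] [NormedAddCommGroup F] [NormedSpace ℝ F]
    (hX : UniformlyFinitistic X) (p : E →L[ℝ] F) (K : ℝ) (hK : 0 < K)
    (hp : ∀ b, ∃ a, p a = b ∧ ‖a‖ ≤ K * ‖b‖)
    (C : ℝ) (hC : 0 < C) (g : X → F) (hgu : UniformContinuous g) (hgb : ∀ x, ‖g x‖ ≤ C) :
    ∃ f : X → E, UniformContinuous f ∧ (∀ x, ‖f x‖ ≤ K * C) ∧ ∀ x, ‖g x - p (f x)‖ ≤ C / 2 := by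
  classical
  choose σ hσ hσn using hp
  have hcov : IsUniformCover (Set.range fun x => g ⁻¹' Metric.ball (g x) (C / 4)) := by
    refine ⟨{q | dist (g q.1) (g q.2) < C / 4},
      hgu (Metric.dist_mem_uniformity (by positivity)), fun x => ⟨_, ⟨x, rfl⟩, ?_⟩⟩
    intro y hy
    have : dist (g x) (g y) < C / 4 := hy
    simpa [dist_comm] using this
  obtain ⟨𝒱, -, ⟨V, hV, hVc⟩, href, n, hn⟩ := hX _ (by
    rintro _ ⟨x, rfl⟩
    exact Metric.isOpen_ball.preimage hgu.continuous) hcov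
  obtain ⟨d, hud, δ, hδ, hdV⟩ := aux_pseudoMetric hV
  obtain ⟨φ, T, L, hL0, hφ0, hT, hφT, hφ1, hφL, hTc⟩ := @aux_partition X d 𝒱 n hn δ hδ (by
    intro x
    obtain ⟨U, hU, h⟩ := hVc x
    exact ⟨U, hU, fun y hy => h (hdV x y hy)⟩)
  let b : Set X → F := fun U => if h : U.Nonempty then g h.some else 0
  have hb : ∀ U, ‖b U‖ ≤ C := by
    intro U
    simp only [b]
    split_ifs
    · exact hgb _
    · simpa using hC.le
  have hbU : ∀ x, ∀ U ∈ T x, ‖g x - b U‖ ≤ C / 2 := by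
    intro x U hU
    obtain ⟨hU, hx⟩ := (hT x U).1 hU
    have hne : U.Nonempty := ⟨x, hx⟩
    obtain ⟨_, ⟨z, rfl⟩, hz⟩ := href U hU
    have h1 : dist (g x) (g z) < C / 4 := hz hx
    have h2 : dist (g hne.some) (g z) < C / 4 := hz hne.some_mem
    simp only [b, dif_pos hne]
    rw [← dist_eq_norm]
    linarith [dist_triangle_right (g x) (g hne.some) (g z)]
  have ha : ∀ U, ‖σ (b U)‖ ≤ K * C := fun U =>
    (hσn _).trans (mul_le_mul_of_nonneg_left (hb U) hK.le)
  let f : X → E := fun x => ∑ U ∈ T x, φ U x • σ (b U)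
  have hf : ∀ x (R : Finset (Set X)), T x ⊆ R → f x = ∑ U ∈ R, φ U x • σ (b U) := fun x R h =>
    Finset.sum_subset h (fun U _ hU => by rw [hφT x U hU, zero_smul])
  refine ⟨f, ?_, ?_, ?_⟩
  · have hlip : ∀ x y, dist (f x) (f y) ≤ (2 * n * (L * (K * C))) * d.dist x y := by
      intro x y
      rw [hf x (T x ∪ T y) Finset.subset_union_left, hf y (T x ∪ T y) Finset.subset_union_right,
        dist_eq_norm, ← Finset.sum_sub_distrib]
      have hd0 : 0 ≤ d.dist x y := @dist_nonneg X d x y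
      have hb : ∀ U ∈ T x ∪ T y, ‖φ U x • σ (b U) - φ U y • σ (b U)‖
          ≤ (L * d.dist x y) * (K * C) := by
        intro U _
        rw [← sub_smul, norm_smul, Real.norm_eq_abs]
        exact mul_le_mul (hφL U x y) (ha U) (norm_nonneg _) (mul_nonneg hL0 hd0)
      refine (norm_sum_le_of_le _ hb).trans ?_
      rw [Finset.sum_const, nsmul_eq_mul]
      have hc : (T x ∪ T y).card ≤ 2 * n := (Finset.card_union_le _ _).trans (by
        have := hTc x
        have := hTc y
        omega)
      have hc' : ((T x ∪ T y).card : ℝ) ≤ 2 * n := by exact_mod_cast hc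
      have := mul_le_mul_of_nonneg_right hc'
        (show 0 ≤ (L * d.dist x y) * (K * C) by positivity)
      linarith
    have hM : 0 ≤ 2 * n * (L * (K * C)) := by positivity
    have : @UniformContinuous X E d.toUniformSpace _ f :=
      (@LipschitzWith.of_dist_le_mul X E d _ ⟨_, hM⟩ f hlip).uniformContinuous
    exact this.mono_left hud
  · intro x
    have h : ∀ U ∈ T x, ‖φ U x • σ (b U)‖ ≤ φ U x * (K * C) := fun U _ => by
      rw [norm_smul, Real.norm_of_nonneg (hφ0 U x)]
      exact mul_le_mul_of_nonneg_left (ha U) (hφ0 U x)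
    refine (norm_sum_le_of_le _ h).trans ?_
    rw [← Finset.sum_mul, hφ1, one_mul]
  · intro x
    have e : g x - p (f x) = ∑ U ∈ T x, φ U x • (g x - b U) := by
      simp only [smul_sub, Finset.sum_sub_distrib, ← Finset.sum_smul, hφ1, one_smul, f, map_sum,
        map_smul, hσ]
    have h : ∀ U ∈ T x, ‖φ U x • (g x - b U)‖ ≤ φ U x * (C / 2) := fun U hU => by
      rw [norm_smul, Real.norm_of_nonneg (hφ0 U x)]
      exact mul_le_mul_of_nonneg_left (hbU x U hU) (hφ0 U x)
    rw [e]
    refine (norm_sum_le_of_le _ h).trans ?_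
    rw [← Finset.sum_mul, hφ1, one_mul]

open Filter Topology in
/-- The Banach space version of the theorem. -/
theorem aux_banach {X E F : Type*} [UniformSpace X]
    [NormedAddCommGroup E] [NormedSpace ℝ E] [CompleteSpace E]
    [NormedAddCommGroup F] [NormedSpace ℝ F]
    (hX : UniformlyFinitistic X) (p : E →L[ℝ] F) (K : ℝ) (hK : 0 < K)
    (hp : ∀ b, ∃ a, p a = b ∧ ‖a‖ ≤ K * ‖b‖)
    (C : ℝ) (hC : 0 < C) (g : X → F) (hgu : UniformContinuous g) (hgb : ∀ x, ‖g x‖ ≤ C) :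
    ∃ f : X → E, UniformContinuous f ∧ (∃ C : ℝ, ∀ x, ‖f x‖ ≤ C) ∧ ∀ x, p (f x) = g x := by
  have step := fun (k : ℕ) (g : {g : X → F // UniformContinuous g ∧ ∀ x, ‖g x‖ ≤ C * (1/2)^k}) =>
    aux_step hX p K hK hp (C * (1/2)^k) (by positivity) g.1 g.2.1 g.2.2
  choose Φ hΦu hΦb hΦ using step
  let G : (k : ℕ) → {g : X → F // UniformContinuous g ∧ ∀ x, ‖g x‖ ≤ C * (1/2)^k} := fun k =>
    Nat.rec ⟨g, hgu, by simpa using hgb⟩ (fun k h => ⟨fun x => h.1 x - p (Φ k h x),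
      h.2.1.sub (p.uniformContinuous.comp (hΦu k h)), fun x => (hΦ k h x).trans (by
        rw [pow_succ]
        exact le_of_eq (by ring))⟩) k
  have hG0 : (G 0).1 = g := rfl
  have hGs : ∀ k x, (G (k+1)).1 x = (G k).1 x - p (Φ k (G k) x) := fun k x => rfl
  let Fk : ℕ → X → E := fun k => Φ k (G k)
  have hFb : ∀ k x, ‖Fk k x‖ ≤ K * (C * (1/2)^k) := fun k x => hΦb k (G k) x
  have hgeo : HasSum (fun k : ℕ => K * (C * (1/2 : ℝ)^k)) (K * (C * 2)) :=
    (hasSum_geometric_two.mul_left C).mul_left K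
  have hunif := tendstoUniformly_tsum_nat hgeo.summable hFb
  refine ⟨fun x => ∑' k, Fk k x, ?_, ⟨K * (C * 2), fun x => ?_⟩, fun x => ?_⟩
  · refine hunif.uniformContinuous (Eventually.of_forall fun N => ?_).frequently
    induction N with
    | zero => simpa using uniformContinuous_const
    | succ N ih =>
      simp only [Finset.sum_range_succ]
      exact ih.add (hΦu N (G N))
  · exact tsum_of_norm_bounded hgeo (fun k => hFb k x)
  · have h1 : Tendsto (fun N => p (∑ k ∈ Finset.range N, Fk k x)) atTop
        (𝓝 (p (∑' k, Fk k x))) :=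
      (p.continuous.tendsto _).comp (hunif.tendsto_at x)
    have h2 : ∀ N, p (∑ k ∈ Finset.range N, Fk k x) = g x - (G N).1 x := by
      intro N
      induction N with
      | zero => simp [hG0]
      | succ N ih =>
        rw [Finset.sum_range_succ, map_add, ih, hGs]
        simp only [Fk]
        abel
    have h3 : Tendsto (fun N => (G N).1 x) atTop (𝓝 0) := by
      refine squeeze_zero_norm (fun N => (G N).2.2 x) ?_
      have := (tendsto_pow_atTop_nhds_zero_of_lt_one (r := (1/2 : ℝ)) (by norm_num)
        (by norm_num)).const_mul C
      simpa using this
    have h4 : Tendsto (fun N => g x - (G N).1 x) atTop (𝓝 (g x - 0)) := h3.const_sub (g x)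
    simp only [h2] at h1
    rw [sub_zero] at h4
    exact tendsto_nhds_unique h1 h4

/-- Let `X` be a uniformly finitistic uniform space and `π : A → B` a
surjective *-homomorphism of C*-algebras. Then every bounded uniformly continuous
`g : X → B` lifts to a bounded uniformly continuous `f : X → A` with `π ∘ f = g`. -/
theorem stmt_12 {X A B : Type*} [UniformSpace X]
    [NonUnitalCStarAlgebra A] [NonUnitalCStarAlgebra B]
    (hX : UniformlyFinitistic X)
    (π : A →⋆ₙₐ[ℂ] B) (hπ : Function.Surjective π)
    (g : X → B) (hgu : UniformContinuous g) (hgb : ∃ C : ℝ, ∀ x, ‖g x‖ ≤ C) :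
    ∃ f : X → A, UniformContinuous f ∧ (∃ C : ℝ, ∀ x, ‖f x‖ ≤ C) ∧
      ∀ x, π (f x) = g x := by
  obtain ⟨C, hC⟩ := hgb
  have hcont : Continuous π :=
    (NonUnitalStarAlgHom.instContinuousLinearMapClassComplex (F := A →⋆ₙₐ[ℂ] B)).map_continuous π
  let p : A →L[ℂ] B := ⟨⟨⟨π, map_add π⟩, map_smul π⟩, hcont⟩
  obtain ⟨K, hK, hp⟩ := p.exists_preimage_norm_le hπ
  obtain ⟨f, hf, hfb, hfg⟩ := aux_banach hX (p.restrictScalars ℝ) K hK hp (max C 1)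
    (by positivity) g hgu (fun x => (hC x).trans (le_max_left _ _))
  exact ⟨f, hf, hfb, hfg⟩
end

section
/- Let X be a paracompact Hausdorff topological space and let π : A → B be a surjective *-homomorphism between C*-algebras. Then the induced map from the bounded continuous A-valued functions on X to the bounded continuous B-valued functions on X, given by f ↦ π ∘ f, is surjective; that is, every bounded continuous g : X → B lifts to a bounded continuous f : X → A with π ∘ f = g. -/
open Topology in
theorem lift_approx_aux {X A B : Type*} [TopologicalSpace X] [T2Space X] [ParacompactSpace X]
    [NormedAddCommGroup A] [NormedSpace ℝ A] [NormedAddCommGroup B] [NormedSpace ℝ B]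
    (p : A →L[ℝ] B) (C : ℝ) (hC : 0 < C) (hp : ∀ y, ∃ x, p x = y ∧ ‖x‖ ≤ C * ‖y‖)
    (M : ℝ) (hM : 0 < M) (g : C(X, B)) (hg : ∀ x, ‖g x‖ ≤ M) :
    ∃ f : C(X, A), (∀ x, ‖f x‖ ≤ C * M) ∧ ∀ x, ‖g x - p (f x)‖ ≤ M / 2 := by
  have key := exists_continuous_forall_mem_convex_of_local_const (X := X) (E := A)
    (t := fun x => Metric.closedBall 0 (C * M) ∩ p ⁻¹' (Metric.closedBall (g x) (M / 2)))
    (fun x => (convex_closedBall _ _).inter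
      ((convex_closedBall (g x) (M / 2)).linear_preimage p.toLinearMap)) ?_
  · obtain ⟨f, hf⟩ := key
    refine ⟨f, fun x => by simpa using (hf x).1, fun x => ?_⟩
    have := (hf x).2
    rw [Set.mem_preimage, Metric.mem_closedBall, dist_comm, dist_eq_norm] at this
    exact this
  · intro x
    obtain ⟨c, hc, hcn⟩ := hp (g x)
    refine ⟨c, ?_⟩
    have h1 : ∀ᶠ y in 𝓝 x, dist (g y) (g x) < M / 2 :=
      Metric.tendsto_nhds.1 (g.continuous.tendsto x) _ (by positivity)
    filter_upwards [h1] with y hy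
    refine ⟨?_, ?_⟩
    · rw [mem_closedBall_zero_iff]
      exact hcn.trans (mul_le_mul_of_nonneg_left (hg x) hC.le)
    · rw [Set.mem_preimage, Metric.mem_closedBall, hc, dist_comm]
      exact hy.le

theorem lift_aux {X A B : Type*} [TopologicalSpace X] [T2Space X] [ParacompactSpace X]
    [NormedAddCommGroup A] [NormedSpace ℝ A] [NormedAddCommGroup B] [NormedSpace ℝ B]
    [CompleteSpace A]
    (p : A →L[ℝ] B) (C : ℝ) (hC : 0 < C) (hp : ∀ y, ∃ x, p x = y ∧ ‖x‖ ≤ C * ‖y‖)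
    (M : ℝ) (hM : 0 < M) (g : C(X, B)) (hg : ∀ x, ‖g x‖ ≤ M) :
    ∃ f : X → A, Continuous f ∧ (∃ C : ℝ, ∀ x, ‖f x‖ ≤ C) ∧ ∀ x, p (f x) = g x := by
  have step : ∀ (n : ℕ) (h : C(X, B)), ∃ f : C(X, A), (∀ x, ‖h x‖ ≤ M * (1 / 2) ^ n) →
      (∀ x, ‖f x‖ ≤ C * (M * (1 / 2) ^ n)) ∧
        ∀ x, ‖h x - p (f x)‖ ≤ M * (1 / 2) ^ (n + 1) := by
    intro n h
    by_cases hh : ∀ x, ‖h x‖ ≤ M * (1 / 2) ^ n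
    · obtain ⟨f, h1, h2⟩ := lift_approx_aux p C hC hp (M * (1 / 2) ^ n) (by positivity) h hh
      refine ⟨f, fun _ => ⟨h1, fun x => (h2 x).trans (le_of_eq ?_)⟩⟩
      ring
    · exact ⟨0, fun h' => absurd h' hh⟩
  choose F hF using step
  let G : ℕ → C(X, B) := fun n => Nat.rec g (fun n h => h - (p : C(A, B)).comp (F n h)) n
  have hG : ∀ n x, G (n + 1) x = G n x - p (F n (G n) x) := fun n x => rfl
  have hGb : ∀ n x, ‖G n x‖ ≤ M * (1 / 2) ^ n := by
    intro n
    induction n with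
    | zero => intro x; simpa [G] using hg x
    | succ n ih => intro x; rw [hG]; exact (hF n (G n) ih).2 x
  have hFb : ∀ n x, ‖F n (G n) x‖ ≤ C * (M * (1 / 2) ^ n) := fun n x => (hF n (G n) (hGb n)).1 x
  have hs : Summable fun n : ℕ => C * (M * (1 / 2 : ℝ) ^ n) :=
    (summable_geometric_two.mul_left M).mul_left C
  refine ⟨fun x => ∑' n, F n (G n) x,
    continuous_tsum (fun n => (F n (G n)).continuous) hs hFb,
    ⟨∑' n : ℕ, C * (M * (1 / 2 : ℝ) ^ n), fun x =>
      tsum_of_norm_bounded hs.hasSum fun n => hFb n x⟩, fun x => ?_⟩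
  have hsx : Summable fun n => F n (G n) x := Summable.of_norm_bounded hs fun n => hFb n x
  have h1 := (p.hasSum hsx.hasSum).tendsto_sum_nat
  have h2 : ∀ n, ∑ i ∈ Finset.range n, p (F i (G i) x) = g x - G n x := by
    intro n
    induction n with
    | zero => simp [G]
    | succ n ih => rw [Finset.sum_range_succ, ih, hG]; abel
  have h3 : Filter.Tendsto (fun n => G n x) Filter.atTop (nhds 0) := by
    refine squeeze_zero_norm (fun n => hGb n x) ?_
    simpa using (tendsto_pow_atTop_nhds_zero_of_lt_one (r := (1 / 2 : ℝ))
      (by norm_num) (by norm_num)).const_mul M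
  have h4 := (tendsto_const_nhds (x := g x)).sub h3
  simp only [sub_zero] at h4
  refine tendsto_nhds_unique h1 ?_
  simpa only [Function.comp_apply, h2] using h4

/-- Let `X` be a paracompact Hausdorff space and `π : A → B` a surjective
*-homomorphism of C*-algebras. Then every bounded continuous `g : X → B` lifts to a
bounded continuous `f : X → A` with `π ∘ f = g`. -/
theorem stmt_13 {X A B : Type*} [TopologicalSpace X] [T2Space X] [ParacompactSpace X]
    [NonUnitalCStarAlgebra A] [NonUnitalCStarAlgebra B]
    (π : A →⋆ₙₐ[ℂ] B) (hπ : Function.Surjective π)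
    (g : X → B) (hgc : Continuous g) (hgb : ∃ C : ℝ, ∀ x, ‖g x‖ ≤ C) :
    ∃ f : X → A, Continuous f ∧ (∃ C : ℝ, ∀ x, ‖f x‖ ≤ C) ∧ ∀ x, π (f x) = g x := by
  have hc : Continuous π := AddMonoidHomClass.continuous_of_bound π 1 fun a => by
    simpa only [one_mul] using NonUnitalStarAlgHom.norm_apply_le π a
  let q : A →L[ℂ] B := ⟨⟨⟨π, map_add π⟩, map_smul π⟩, hc⟩
  obtain ⟨C, hC, hp⟩ := q.exists_preimage_norm_le hπ
  obtain ⟨M, hM⟩ := hgb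
  exact lift_aux (q.restrictScalars ℝ) C hC hp (max M 1) (by positivity) ⟨g, hgc⟩
    fun x => (hM x).trans (le_max_left _ _)
end

section
/- Let π : A → B be a surjective *-homomorphism between C*-algebras. Then there exists a continuous (not necessarily linear) map σ : B → A such that π(σ(b)) = b for all b ∈ B, and such that there is a constant M with ‖σ(b)‖ ≤ M·‖b‖ for all b ∈ B. -/
theorem bg_approx {E F : Type*} [NormedAddCommGroup E] [NormedSpace ℝ E]
    [NormedAddCommGroup F] [NormedSpace ℝ F] (T : E →L[ℝ] F) (C : ℝ) (hC0 : 0 < C)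
    (hC : ∀ y, ∃ x, T x = y ∧ ‖x‖ ≤ C * ‖y‖) :
    ∃ g : F → E, Continuous g ∧ ∀ b, ‖b - T (g b)‖ ≤ ‖b‖ / 2 ∧ ‖g b‖ ≤ 2 * C * ‖b‖ := by
  let U : Set F := {0}ᶜ
  have hU : IsOpen U := isOpen_compl_singleton
  let t : U → Set E := fun b => {a | ‖(b : F) - T a‖ ≤ ‖(b : F)‖ / 2 ∧ ‖a‖ ≤ 2 * C * ‖(b : F)‖}
  have ht : ∀ b, Convex ℝ (t b) := by
    intro b
    have h1 : Convex ℝ (T ⁻¹' Metric.closedBall (b : F) (‖(b : F)‖ / 2)) :=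
      (convex_closedBall (b : F) _).linear_preimage (T : E →ₗ[ℝ] F)
    have h2 : Convex ℝ (Metric.closedBall (0 : E) (2 * C * ‖(b : F)‖)) := convex_closedBall _ _
    convert h1.inter h2 using 1
    ext a
    simp only [t, Set.mem_ofPred_eq, Set.mem_inter_iff, Set.mem_preimage, Metric.mem_closedBall,
      sub_zero, dist_eq_norm, norm_sub_rev]
  obtain ⟨f, hf⟩ := exists_continuous_forall_mem_convex_of_local_const ht (by
    intro b
    obtain ⟨c, hc, hcn⟩ := hC b
    have hb : 0 < ‖(b : F)‖ := norm_pos_iff.2 b.2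
    refine ⟨c, ?_⟩
    have : ∀ᶠ y : U in nhds b, ‖(y : F) - b‖ < ‖(b : F)‖ / 3 := by
      have hcont : Continuous fun y : U => ‖(y : F) - b‖ := by fun_prop
      apply hcont.continuousAt.eventually_lt continuousAt_const
      simpa using hb
    filter_upwards [this] with y hy
    have h3 : ‖(b : F)‖ ≤ ‖(y : F)‖ + ‖(y : F) - b‖ := by
      rw [norm_sub_rev]
      have := norm_add_le (y : F) ((b : F) - y)
      simpa using this
    refine ⟨?_, ?_⟩
    · rw [hc]; linarith
    · have : C * ‖(b : F)‖ ≤ C * (2 * ‖(y : F)‖) := by gcongr; linarith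
      linarith)
  classical
  let g : F → E := fun b => if h : b ∈ U then f ⟨b, h⟩ else 0
  have hg : ∀ b, ‖b - T (g b)‖ ≤ ‖b‖ / 2 ∧ ‖g b‖ ≤ 2 * C * ‖b‖ := by
    intro b
    by_cases h : b ∈ U
    · simp only [g, dif_pos h]
      exact hf ⟨b, h⟩
    · have hb : b = 0 := by simpa [U] using h
      simp only [g, dif_neg h]
      simp [hb]
  refine ⟨g, ?_, hg⟩
  rw [continuous_iff_continuousAt]
  intro b
  by_cases h : b ∈ U
  · have : ContinuousOn g U := by
      rw [continuousOn_iff_continuous_domRestrict]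
      convert f.continuous using 1
      ext x
      simp [g]
    exact this.continuousAt (hU.mem_nhds h)
  · have hb : b = 0 := by simpa [U] using h
    have h0 : g b = 0 := by simp only [g, dif_neg h]
    rw [ContinuousAt, h0]
    refine squeeze_zero_norm (fun x => (hg x).2) ?_
    have : Continuous fun x : F => 2 * C * ‖x‖ := by fun_prop
    simpa [hb] using this.tendsto b

theorem bg_real {E F : Type*} [NormedAddCommGroup E] [NormedSpace ℝ E] [CompleteSpace E]
    [NormedAddCommGroup F] [NormedSpace ℝ F] [CompleteSpace F] (T : E →L[ℝ] F)
    (hT : Function.Surjective T) :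
    ∃ σ : F → E, Continuous σ ∧ (∀ b, T (σ b) = b) ∧ ∃ M : ℝ, ∀ b, ‖σ b‖ ≤ M * ‖b‖ := by
  obtain ⟨C, hC0, hC⟩ := T.exists_preimage_norm_le hT
  obtain ⟨g, hgc, hg⟩ := bg_approx T C hC0 hC
  let r : F → F := fun b => b - T (g b)
  have hrc : Continuous r := by fun_prop
  have hr : ∀ n b, ‖r^[n] b‖ ≤ ‖b‖ * (1 / 2) ^ n := by
    intro n b
    induction n with
    | zero => simp
    | succ n ih =>
      rw [Function.iterate_succ_apply', pow_succ]
      have := (hg (r^[n] b)).1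
      change ‖r (r^[n] b)‖ ≤ _ at this
      linarith
  have hb : ∀ n b, ‖g (r^[n] b)‖ ≤ 2 * C * ‖b‖ * (1 / 2) ^ n := by
    intro n b
    have h1 := (hg (r^[n] b)).2
    have h2 : 2 * C * ‖r^[n] b‖ ≤ 2 * C * (‖b‖ * (1 / 2) ^ n) := by gcongr; exact hr n b
    linarith
  have hs : ∀ R : ℝ, HasSum (fun n : ℕ => R * (1 / 2 : ℝ) ^ n) (R * 2) :=
    fun R => hasSum_geometric_two.mul_left R
  have hsum : ∀ b, Summable fun n => g (r^[n] b) := fun b =>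
    Summable.of_norm_bounded (hs _).summable (fun n => hb n b)
  refine ⟨fun b => ∑' n, g (r^[n] b), ?_, ?_, 4 * C, ?_⟩
  · rw [continuous_iff_continuousAt]
    intro b
    have : ContinuousOn (fun b => ∑' n, g (r^[n] b)) (Metric.ball 0 (‖b‖ + 1)) := by
      refine continuousOn_tsum (u := fun n => 2 * C * (‖b‖ + 1) * (1 / 2) ^ n)
        (fun n => (hgc.comp (hrc.iterate n)).continuousOn) (hs _).summable ?_
      intro n x hx
      refine (hb n x).trans ?_
      have : ‖x‖ ≤ ‖b‖ + 1 := by simpa using (Metric.mem_ball.1 hx).le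
      gcongr
    exact this.continuousAt (Metric.isOpen_ball.mem_nhds (by simp))
  · intro b
    have h1 : HasSum (fun n => T (g (r^[n] b))) (T (∑' n, g (r^[n] b))) :=
      T.hasSum (hsum b).hasSum
    have h2 := h1.tendsto_sum_nat
    have h3 : ∀ n, ∑ i ∈ Finset.range n, T (g (r^[i] b)) = b - r^[n] b := by
      intro n
      induction n with
      | zero => simp
      | succ n ih =>
        rw [Finset.sum_range_succ, ih, Function.iterate_succ_apply']
        simp only [r]
        abel
    simp only [h3] at h2
    have h4 : Filter.Tendsto (fun n => r^[n] b) Filter.atTop (nhds 0) :=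
      squeeze_zero_norm (fun n => hr n b) (hs _).summable.tendsto_atTop_zero
    have h5 := h4.const_sub b
    rw [sub_zero] at h5
    exact tendsto_nhds_unique h2 h5
  · intro b
    have := tsum_of_norm_bounded (hs (2 * C * ‖b‖)) (fun n => hb n b)
    linarith

/-- C*-algebraic Bartle–Graves. Let `π : A → B` be a surjective
*-homomorphism of C*-algebras. Then there is a continuous (not necessarily linear) map
`σ : B → A` with `π (σ b) = b` for all `b`, and a constant `M` with `‖σ b‖ ≤ M * ‖b‖`. -/
theorem stmt_14 {A B : Type*} [NonUnitalCStarAlgebra A] [NonUnitalCStarAlgebra B]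
    (π : A →⋆ₙₐ[ℂ] B) (hπ : Function.Surjective π) :
    ∃ σ : B → A, Continuous σ ∧ (∀ b : B, π (σ b) = b) ∧
      ∃ M : ℝ, ∀ b : B, ‖σ b‖ ≤ M * ‖b‖ := by
  let L : A →ₗ[ℝ] B :=
    { toFun := π
      map_add' := map_add π
      map_smul' := by
        intro c x
        have := map_smul π (c : ℂ) x
        simpa using this }
  let T : A →L[ℝ] B := L.mkContinuous 1 (by
    intro x
    rw [one_mul]
    exact NonUnitalStarAlgHom.norm_apply_le π x)
  exact bg_real T hπ
end
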